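/- Let H be a maximal subgroup of a finite solvable group G with |G : H| = p^a, where p is a prime and a is a positive integer. Let K be a subgroup of G isomorphic to H (as abstract groups), and suppose K is not maximal in G. Then p ≤ 3, and, setting q = 5 − p, one has O_{q'}(H) = O_{q'}(G) = O_{q'}(K); moreover, writing G* = G/O_{q'}(G) and letting H* and K* denote the images of H and K in G*, the subgroups H* and K* of G* are isomorphic, H* is maximal in G*, and K* is not maximal in G*. (Theorem 2.3) -/

import Mathlib

/-- `O_{p'}(G)`: the `p'`-core of `G`, i.e. the largest normal subgroup of `G` whose order is
coprime to `p` (for finite `G` the join of all such normal subgroups is the largest one). -/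
def pPrimeCore (p : ℕ) (G : Type*) [Group G] : Subgroup G :=
  sSup {N : Subgroup G | N.Normal ∧ (Nat.card N).Coprime p}

open Subgroup

section Cores

variable {G : Type*} [Group G]

theorem card_sup_mul_card_inf (M N : Subgroup G) [N.Normal] :
    Nat.card (M ⊔ N : Subgroup G) * Nat.card (M ⊓ N : Subgroup G) = Nat.card M * Nat.card N := by
  have h1 := relIndex_mul_relIndex ⊥ N (M ⊔ N) bot_le le_sup_right
  have h2 := relIndex_mul_relIndex ⊥ (M ⊓ N) M bot_le inf_le_left
  rw [relIndex_sup_right, relIndex_bot_left, relIndex_bot_left] at h1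
  rw [inf_relIndex_left, relIndex_bot_left, relIndex_bot_left] at h2
  rw [← h1, ← h2]
  ring

theorem card_sup_dvd (M N : Subgroup G) [N.Normal] :
    Nat.card (M ⊔ N : Subgroup G) ∣ Nat.card M * Nat.card N :=
  ⟨_, (card_sup_mul_card_inf M N).symm⟩

theorem pPrimeCore_normal (r : ℕ) : (pPrimeCore r G).Normal :=
  sSup_normal _ fun _ h => h.1

theorem pPrimeCore_coprime [Finite G] (r : ℕ) : (Nat.card (pPrimeCore r G)).Coprime r := by
  have h := CompleteLattice.WellFoundedGT.isSupClosedCompact (Subgroup G) inferInstance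
    {N : Subgroup G | N.Normal ∧ (Nat.card N).Coprime r} ⟨⊥, inferInstance, by simp⟩ ?_
  · exact h.2
  · rintro M ⟨hM, hMc⟩ N ⟨hN, hNc⟩
    exact ⟨sup_normal M N, Nat.Coprime.coprime_dvd_left (card_sup_dvd M N)
      (Nat.Coprime.mul_left hMc hNc)⟩

theorem le_pPrimeCore {r : ℕ} {N : Subgroup G} (hN : N.Normal) (h : (Nat.card N).Coprime r) :
    N ≤ pPrimeCore r G := le_sSup ⟨hN, h⟩

theorem card_map_of_injective' {G' : Type*} [Group G'] (f : G →* G') (hf : Function.Injective f)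
    (N : Subgroup G) : Nat.card (N.map f) = Nat.card N :=
  (Nat.card_congr (N.equivMapOfInjective f hf).toEquiv).symm

theorem map_pPrimeCore_le {G' : Type*} [Group G'] [Finite G] (e : G ≃* G') (r : ℕ) :
    (pPrimeCore r G).map e.toMonoidHom ≤ pPrimeCore r G' := by
  have := pPrimeCore_normal (G := G) r
  refine le_pPrimeCore (Normal.map this _ e.surjective) ?_
  rw [card_map_of_injective' _ e.injective]
  exact pPrimeCore_coprime r

theorem map_pPrimeCore {G' : Type*} [Group G'] [Finite G] [Finite G'] (e : G ≃* G') (r : ℕ) :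
    (pPrimeCore r G).map e.toMonoidHom = pPrimeCore r G' := by
  refine le_antisymm (map_pPrimeCore_le e r) fun x hx => ?_
  exact ⟨e.symm x, map_pPrimeCore_le e.symm r ⟨x, hx, rfl⟩, by simp⟩

theorem pPrimeCore_characteristic [Finite G] (r : ℕ) : (pPrimeCore r G).Characteristic :=
  characteristic_iff_map_eq.2 fun e => map_pPrimeCore e r

/-- The largest normal `r`-subgroup of a group. -/
def pCore (r : ℕ) (G : Type*) [Group G] : Subgroup G :=
  sSup {N : Subgroup G | N.Normal ∧ IsPGroup r N}

theorem pCore_normal (r : ℕ) : (pCore r G).Normal :=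
  sSup_normal _ fun _ h => h.1

theorem pCore_isPGroup [Finite G] (r : ℕ) : IsPGroup r (pCore r G) := by
  have h := CompleteLattice.WellFoundedGT.isSupClosedCompact (Subgroup G) inferInstance
    {N : Subgroup G | N.Normal ∧ IsPGroup r N} ⟨⊥, inferInstance, IsPGroup.of_bot⟩ ?_
  · exact h.2
  · rintro M ⟨hM, hMc⟩ N ⟨hN, hNc⟩
    exact ⟨sup_normal M N, IsPGroup.to_sup_of_normal_right hMc hNc⟩

theorem le_pCore {r : ℕ} {N : Subgroup G} (hN : N.Normal) (h : IsPGroup r N) :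
    N ≤ pCore r G := le_sSup ⟨hN, h⟩

theorem pCore_characteristic [Finite G] (r : ℕ) : (pCore r G).Characteristic := by
  have hle : ∀ e : G ≃* G, (pCore r G).map e.toMonoidHom ≤ pCore r G := fun e =>
    le_pCore (Normal.map (pCore_normal r) _ e.surjective) ((pCore_isPGroup r).map _)
  refine characteristic_iff_map_eq.2 fun e => le_antisymm (hle e) fun x hx => ?_
  exact ⟨e.symm x, hle e.symm ⟨x, hx, rfl⟩, by simp⟩

theorem coprime_card_of_isPGroup [Finite G] {r s : ℕ} (hr : r.Prime) (hs : s.Prime) (hrs : r ≠ s)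
    {N : Subgroup G} (h : IsPGroup r N) : (Nat.card N).Coprime s := by
  have := Fact.mk hr
  obtain ⟨n, hn⟩ := IsPGroup.iff_card.1 h
  rw [hn]
  exact Nat.Coprime.pow_left _ ((Nat.coprime_primes hr hs).2 hrs)

theorem le_pCore_of_commutator_le [Finite G] {r : ℕ} (hr : r.Prime) (h : pPrimeCore r G = ⊥)
    {B : Subgroup G} (hB : B.Normal) (hBc : B ≤ centralizer (pCore r G : Set G))
    (hB' : ⁅B, B⁆ ≤ pCore r G) : B ≤ pCore r G := by
  have := Fact.mk hr
  have hnil : Group.IsNilpotent ↥B := by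
    refine Subgroup.isNilpotent_of_ker_le_center (H := Abelianization ↥B) Abelianization.of ?_
    intro x hx
    rw [Abelianization.ker_of] at hx
    have hx1 : (x : G) ∈ ⁅B, B⁆ := by
      have : (x : G) ∈ (commutator B).map B.subtype := ⟨x, hx, rfl⟩
      rwa [commutator_def, map_commutator, ← MonoidHom.range_eq_map, range_subtype] at this
    refine mem_center_iff.2 fun y => Subtype.ext ?_
    have := mem_centralizer_iff.1 (hBc y.2) x (hB' hx1)
    simpa using this.symm
  have hsyl : ∀ s (_ : Fact s.Prime) (P : Sylow s ↥B), (P : Subgroup B).Normal :=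
    (Group.isNilpotent_of_finite_tfae.out 0 3).1 hnil
  have hpow : ∀ {s : ℕ}, s.Prime → s ∣ Nat.card B → s = r := by
    intro s hs hsd
    by_contra hsr
    have := Fact.mk hs
    obtain ⟨P⟩ : Nonempty (Sylow s ↥B) := inferInstance
    have := P.characteristic_of_normal (hsyl s this P)
    have hPn : ((P : Subgroup B).map B.subtype).Normal :=
      ConjAct.normal_of_characteristic_of_normal
    have : (P : Subgroup B).map B.subtype ≤ pPrimeCore r G :=
      le_pPrimeCore hPn (coprime_card_of_isPGroup hs hr hsr (P.2.map _))
    rw [h, le_bot_iff, map_eq_bot_iff_of_injective _ B.subtype_injective] at this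
    exact P.ne_bot_of_dvd_card hsd this
  refine le_pCore inferInstance ?_
  refine IsPGroup.iff_card.2 ⟨_, Nat.eq_prime_pow_of_unique_prime_dvd Nat.card_pos.ne' hpow⟩

/-- Hall–Higman: in a solvable group with trivial `r'`-core, the `r`-core contains its own
centralizer. -/
theorem centralizer_pCore_le [Finite G] (hG : Group.IsSolvable G) {r : ℕ} (hr : r.Prime)
    (h : pPrimeCore r G = ⊥) : centralizer (pCore r G : Set G) ≤ pCore r G := by
  have := pCore_normal (G := G) r
  set O := pCore r G with hO
  by_contra hcon
  obtain ⟨n, hn⟩ := (Group.isSolvable_def G).1 hG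
  let c : ℕ → Subgroup G := fun n => Nat.rec (centralizer (O : Set G)) (fun _ N => ⁅N, N⁆) n
  have hc0 : c 0 = centralizer (O : Set G) := rfl
  have hcs : ∀ k, c (k + 1) = ⁅c k, c k⁆ := fun _ => rfl
  have hcn : ∀ k, (c k).Normal := by
    intro k
    induction k with
    | zero => rw [hc0]; infer_instance
    | succ k ih => exact commutator_normal (h₁ := ih) (h₂ := ih) _ _
  have hcle : ∀ k, c k ≤ centralizer (O : Set G) := by
    intro k
    induction k with
    | zero => exact le_rfl
    | succ k ih => have := hcn k; exact (commutator_le_right _ _).trans ih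
  have hcd : ∀ k, c k ≤ derivedSeries G k := by
    intro k
    induction k with
    | zero => simp
    | succ k ih => exact commutator_mono ih ih
  have hex : ∃ k, c k ≤ O := ⟨n, (hcd n).trans (hn ▸ bot_le)⟩
  obtain ⟨k, hB, hB'⟩ : ∃ k, ¬ c k ≤ O ∧ c (k + 1) ≤ O := by
    by_contra! hall
    obtain ⟨m, hm⟩ := hex
    have : ∀ k, ¬ c k ≤ O := fun k => by
      induction k with
      | zero => exact hcon
      | succ k ih => exact hall k ih
    exact this m hm
  rw [hcs] at hB'
  exact hB (le_pCore_of_commutator_le hr h (hcn k) (hcle k) hB')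

end Cores

section Index

variable {G : Type*} [Group G]

theorem card_comap_of_surjective {Q : Type*} [Group Q] (π : G →* Q) (hs : Function.Surjective π)
    (M : Subgroup Q) : Nat.card (M.comap π) = Nat.card π.ker * Nat.card M := by
  have h1 := relIndex_mul_relIndex ⊥ π.ker (M.comap π) bot_le (ker_le_comap π M)
  rw [relIndex_bot_left, relIndex_bot_left, relIndex_ker, map_comap_eq_self_of_surjective hs] at h1
  exact h1.symm

theorem pPrimeCore_eq_bot_of_ker_eq [Finite G] {Q : Type*} [Group Q] (π : G →* Q)
    (hs : Function.Surjective π) {r : ℕ} (hker : π.ker = pPrimeCore r G) :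
    pPrimeCore r Q = ⊥ := by
  have : Finite Q := Finite.of_surjective π hs
  have hn := pPrimeCore_normal (G := Q) r
  have hc := pPrimeCore_coprime (G := Q) r
  have h1 : (pPrimeCore r Q).comap π ≤ π.ker := by
    rw [hker]
    refine le_pPrimeCore inferInstance ?_
    rw [card_comap_of_surjective π hs, hker]
    exact Nat.Coprime.mul_left (pPrimeCore_coprime r) hc
  rw [eq_bot_iff, ← map_comap_eq_self_of_surjective hs (pPrimeCore r Q)]
  exact (map_mono h1).trans ((Subgroup.map_eq_bot_iff _).2 le_rfl).le

theorem relIndex_sup_right_of_normal [Finite G] (K R : Subgroup G) [R.Normal] :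
    K.relIndex (K ⊔ R) = K.relIndex R := by
  have h1 := relIndex_mul_relIndex ⊥ K (K ⊔ R) bot_le le_sup_left
  have h2 := relIndex_mul_relIndex ⊥ (K ⊓ R) R bot_le inf_le_right
  rw [relIndex_bot_left, relIndex_bot_left] at h1
  rw [inf_relIndex_right, relIndex_bot_left, relIndex_bot_left] at h2
  have h3 := card_sup_mul_card_inf K R
  rw [← h1, ← h2] at h3
  have hK : 0 < Nat.card K := Nat.card_pos
  have hKR : 0 < Nat.card (K ⊓ R : Subgroup G) := Nat.card_pos
  refine Nat.eq_of_mul_eq_mul_left (Nat.mul_pos hK hKR) ?_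
  linarith

theorem le_of_coprime_index [Finite G] (K R : Subgroup G) [R.Normal]
    (h : (Nat.card R).Coprime K.index) : R ≤ K := by
  rw [← relIndex_eq_one]
  refine Nat.eq_one_of_dvd_coprimes h ?_ ?_
  · exact relIndex_dvd_card K R
  · rw [← relIndex_sup_right_of_normal]
    exact relIndex_dvd_index_of_le le_sup_left

theorem le_bot_of_pPrimeCore_eq_bot [Finite G] (hG : Group.IsSolvable G) {r : ℕ} (hr : r.Prime)
    (h : pPrimeCore r G = ⊥) {K B : Subgroup G} (hK : K.index.Coprime r)
    (hn : ∀ k ∈ K, ∀ b ∈ B, k * b * k⁻¹ ∈ B) (hB : (Nat.card B).Coprime r) : B = ⊥ := by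
  have := Fact.mk hr
  have := pCore_normal (G := G) r
  have hcard : ∀ m : ℕ, m.Coprime r → (Nat.card (pCore r G)).Coprime m := by
    intro m hm
    obtain ⟨n, hn⟩ := IsPGroup.iff_card.1 (pCore_isPGroup (G := G) r)
    rw [hn]
    exact Nat.Coprime.pow_left _ hm.symm
  have hRK : pCore r G ≤ K := le_of_coprime_index K _ (hcard _ hK)
  have hBR : pCore r G ⊓ B = ⊥ := (disjoint_of_coprime_natCard (hcard _ hB)).eq_bot
  have hBc : B ≤ centralizer (pCore r G : Set G) := by
    intro b hb
    refine mem_centralizer_iff.2 fun ρ hρ => ?_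
    have hmem : ρ * b * ρ⁻¹ * b⁻¹ ∈ pCore r G ⊓ B := by
      refine ⟨?_, B.mul_mem (hn ρ (hRK hρ) b hb) (B.inv_mem hb)⟩
      have := (pCore r G).mul_mem hρ
        (Normal.conj_mem ‹(pCore r G).Normal› _ ((pCore r G).inv_mem hρ) b)
      simpa [mul_assoc] using this
    rw [hBR, mem_bot, mul_inv_eq_one, mul_inv_eq_iff_eq_mul] at hmem
    exact hmem
  rw [eq_bot_iff, ← hBR]
  exact le_inf (hBc.trans (centralizer_pCore_le hG hr h)) le_rfl

theorem le_pPrimeCore_of_coprime_index [Finite G] (hG : Group.IsSolvable G) {r : ℕ} (hr : r.Prime)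
    {K B : Subgroup G} (hK : K.index.Coprime r)
    (hn : ∀ k ∈ K, ∀ b ∈ B, k * b * k⁻¹ ∈ B) (hB : (Nat.card B).Coprime r) :
    B ≤ pPrimeCore r G := by
  have hN := pPrimeCore_normal (G := G) r
  obtain ⟨Q, _, _, π, hs, hker⟩ : ∃ (Q : Type _) (_ : Group Q) (_ : Finite Q) (π : G →* Q),
      Function.Surjective π ∧ π.ker = pPrimeCore r G :=
    ⟨G ⧸ pPrimeCore r G, inferInstance, inferInstance, QuotientGroup.mk' _,
      QuotientGroup.mk'_surjective _, QuotientGroup.ker_mk' _⟩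
  have hsol : Group.IsSolvable Q := Group.isSolvable_of_surjective hs
  have := le_bot_of_pPrimeCore_eq_bot hsol hr (pPrimeCore_eq_bot_of_ker_eq π hs hker)
    (K := K.map π) (B := B.map π)
    (Nat.Coprime.coprime_dvd_left (index_map_dvd K hs) hK) ?_
    (Nat.Coprime.coprime_dvd_left (card_map_dvd _ π) hB)
  · rw [Subgroup.map_eq_bot_iff] at this
    exact this.trans hker.le
  · rintro _ ⟨k, hk, rfl⟩ _ ⟨b, hb, rfl⟩
    exact ⟨_, hn k hk b hb, by simp⟩

/-- The `r'`-core of a subgroup of `r'`-index of a solvable group. -/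
theorem map_pPrimeCore_eq_inf [Finite G] (hG : Group.IsSolvable G) {r : ℕ} (hr : r.Prime)
    {Γ : Type*} [Group Γ] [Finite Γ] (i : Γ →* G) (hi : Function.Injective i)
    (hK : i.range.index.Coprime r) :
    pPrimeCore r Γ = (pPrimeCore r G).comap i := by
  have hN := pPrimeCore_normal (G := G) r
  have hNΓ := pPrimeCore_normal (G := Γ) r
  refine le_antisymm ?_ (le_pPrimeCore inferInstance ?_)
  · rw [← map_le_iff_le_comap]
    refine le_pPrimeCore_of_coprime_index hG hr hK ?_ ?_
    · rintro _ ⟨k, rfl⟩ _ ⟨b, hb, rfl⟩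
      exact ⟨_, hNΓ.conj_mem b hb k, by simp⟩
    · rw [card_map_of_injective' i hi]
      exact pPrimeCore_coprime r
  · rw [← card_map_of_injective' i hi]
    exact Nat.Coprime.coprime_dvd_left (card_dvd_of_le (map_comap_le i _)) (pPrimeCore_coprime r)

end Index

section CoprimeConj

variable {Y : Type*} [Group Y]

theorem eq_one_of_pow_eq_one_of_isPGroup {p r : ℕ} (hp : p.Prime) (hr : r.Prime) (hpr : p ≠ r)
    {D : Subgroup Y} (hD : IsPGroup p D) {n : Y} (hn : n ∈ D) (h : n ^ r = 1) : n = 1 := by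
  have := Fact.mk hp
  obtain ⟨k, hk⟩ := hD ⟨n, hn⟩
  have hk' : n ^ p ^ k = 1 := by simpa using congrArg Subtype.val hk
  have hc : (p ^ k).Coprime r := Nat.Coprime.pow_left _ ((Nat.coprime_primes hp hr).2 hpr)
  have := Nat.eq_one_of_dvd_coprimes hc (orderOf_dvd_of_pow_eq_one hk')
    (orderOf_dvd_of_pow_eq_one h)
  exact orderOf_eq_one_iff.1 this

theorem mem_of_pow_mem_of_isPGroup {p r : ℕ} (hp : p.Prime) (hr : r.Prime) (hpr : p ≠ r)
    {D F : Subgroup Y} (hD : IsPGroup p D) {n : Y} (hn : n ∈ D) (h : n ^ r ∈ F) : n ∈ F := by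
  obtain ⟨k, hk⟩ := hD ⟨n, hn⟩
  have hk' : n ^ p ^ k = 1 := by simpa using congrArg Subtype.val hk
  have hc : (p ^ k).Coprime r := Nat.Coprime.pow_left _ ((Nat.coprime_primes hp hr).2 hpr)
  have hb := Nat.gcd_eq_gcd_ab (p ^ k) r
  rw [hc.gcd_eq_one] at hb
  have : n = (n ^ p ^ k) ^ (Nat.gcdA (p ^ k) r) * (n ^ r) ^ (Nat.gcdB (p ^ k) r) := by
    rw [← zpow_natCast, ← zpow_natCast, ← zpow_mul, ← zpow_mul, ← zpow_add, ← hb]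
    simp
  rw [this, hk']
  simpa using F.zpow_mem h _

/-- If `c` moves `m` by an `r'`-element that it fixes and `c ^ r = 1`, then `c` fixes `m`. -/
theorem commute_of_conj_eq_mul {p r : ℕ} (hp : p.Prime) (hr : r.Prime) (hpr : p ≠ r)
    {D : Subgroup Y} (hD : IsPGroup p D) {c m n : Y} (hn : n ∈ D) (hc : c ^ r = 1)
    (hcn : c * n = n * c) (h : c * m * c⁻¹ = m * n) : c * m = m * c := by
  have key : ∀ k : ℕ, c ^ k * m * (c ^ k)⁻¹ = m * n ^ k := by
    intro k
    induction k with
    | zero => simp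
    | succ k ih =>
      have h2 : c * n ^ k = n ^ k * c := ((show Commute c n from hcn).pow_right k).eq
      calc c ^ (k + 1) * m * (c ^ (k + 1))⁻¹ = c * (c ^ k * m * (c ^ k)⁻¹) * c⁻¹ := by
            rw [pow_succ']; group
        _ = c * (m * n ^ k) * c⁻¹ := by rw [ih]
        _ = (c * m * c⁻¹) * (c * n ^ k * c⁻¹) := by group
        _ = m * n ^ (k + 1) := by rw [h, h2, pow_succ']; group
  have h1 := key r
  rw [hc] at h1
  have h2 : n ^ r = 1 := by simpa using h1
  have h3 := eq_one_of_pow_eq_one_of_isPGroup hp hr hpr hD hn h2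
  rw [h3, mul_one, mul_inv_eq_iff_eq_mul] at h
  exact h

theorem prod_range_pow_mul_eq {B : Type*} [CommMonoid B] {r : ℕ} (hr : r.Prime) (f : ℕ → B)
    (hf : ∀ n, f (n % r) = f n) {k : ℕ} (hk : ¬ r ∣ k) :
    ∏ j ∈ Finset.range r, f (j * k) = ∏ j ∈ Finset.range r, f j := by
  have hmaps : Set.MapsTo (fun j => j * k % r) (Finset.range r : Set ℕ) (Finset.range r : Set ℕ) :=
    fun j _ => by simpa using Nat.mod_lt _ hr.pos
  have hinj : Set.InjOn (fun j => j * k % r) (Finset.range r : Set ℕ) := by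
    intro i hi j hj hij
    have h1 : i * k ≡ j * k [MOD r] := hij
    have h2 : i ≡ j [MOD r] :=
      Nat.ModEq.cancel_right_of_coprime ((Nat.Prime.coprime_iff_not_dvd hr).2 hk) h1
    simp only [Finset.coe_range, Set.mem_Iio] at hi hj
    exact Nat.ModEq.eq_of_lt_of_lt h2 hi hj
  refine Finset.prod_nbij (fun j => j * k % r) hmaps hinj
    (Finset.surjOn_of_injOn_of_card_le _ hmaps hinj le_rfl) fun j _ => (hf _).symm

/-- An elementary abelian group of rank two acting coprimely on `D`, all of whose nontrivial
elements have the same centralizer in `D`, acts trivially. -/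
theorem le_centralizer_of_forall_commute [Finite Y] {p r : ℕ} (hp : p.Prime) (hr : r.Prime)
    (hpr : p ≠ r) {D E : Subgroup Y} (hD : IsPGroup p D) {a b : Y} (ha : a ∈ E) (hb : b ∈ E)
    (hab : a * b = b * a) (har : a ^ r = 1) (hbr : b ^ r = 1)
    (h1 : ∀ s ∈ D, b * s = s * b → s ∈ centralizer (E : Set Y))
    (h2 : ∀ j : ℕ, ∀ s ∈ D, a * b ^ j * s = s * (a * b ^ j) → s ∈ centralizer (E : Set Y)) :
    ∀ n : ℕ, ∀ M : Subgroup Y, Nat.card M = n → M ≤ D →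
      (∀ e ∈ E, ∀ m ∈ M, e * m * e⁻¹ ∈ M) → M ≤ centralizer (E : Set Y) := by
  intro n
  induction n using Nat.strong_induction_on with
  | _ n ih =>
  intro M hMn hMD hEM
  by_cases hM : M = ⊥
  · rw [hM]; exact bot_le
  have := Fact.mk hp
  have hMp : IsPGroup p M := hD.to_le hMD
  have : Group.IsNilpotent M := hMp.isNilpotent
  have hMnt : Nontrivial M := (nontrivial_iff_ne_bot M).2 hM
  let φ : E → (M →* M) := fun c =>
    ((MulAut.conj (c : Y)).toMonoidHom.comp M.subtype).codRestrict M fun m => hEM c c.2 m m.2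
  have hφ : ∀ c m, ((φ c m : M) : Y) = c * m * (c : Y)⁻¹ := fun c m => rfl
  have hM' : (commutator M).map M.subtype ≤ centralizer (E : Set Y) := by
    refine ih _ ?_ _ rfl ((map_subtype_le _).trans hMD) ?_
    · rw [card_map_of_injective' _ M.subtype_injective, ← hMn]
      have hlt : commutator M < ⊤ := Group.IsSolvable.commutator_lt_top_of_nontrivial M
      by_contra! hge
      exact hlt.ne (eq_of_le_of_card_ge le_top (by rwa [Subgroup.card_top]))
    · rintro e he _ ⟨x, hx, rfl⟩
      refine ⟨φ ⟨e, he⟩ x, ?_, rfl⟩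
      have h3 : (commutator M).map (φ ⟨e, he⟩) ≤ commutator M := by
        rw [_root_.commutator_def, map_commutator]
        exact commutator_mono le_top le_top
      exact h3 ⟨x, hx, rfl⟩
  set q : M →* Abelianization M := Abelianization.of with hq
  have hqs : Function.Surjective q := QuotientGroup.mk_surjective
  -- fixed points in the abelianization lift
  have hlift : ∀ c : E, (c : Y) ^ r = 1 →
      (∀ s ∈ D, (c : Y) * s = s * c → s ∈ centralizer (E : Set Y)) →
      ∀ u, Abelianization.map (φ c) u = u →
      u ∈ ((centralizer (E : Set Y)).subgroupOf M).map q := by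
    intro c hc hcD u hu
    obtain ⟨m, rfl⟩ := hqs u
    have hu' : q (φ c m) = q m := by rw [← hu]; rfl
    have hker : m⁻¹ * φ c m ∈ commutator M := by
      rw [← Abelianization.ker_of, MonoidHom.mem_ker, map_mul, map_inv]
      exact inv_mul_eq_one.2 hu'.symm
    refine ⟨m, ?_, rfl⟩
    have hmem : ((m⁻¹ * φ c m : M) : Y) ∈ centralizer (E : Set Y) := hM' ⟨_, hker, rfl⟩
    refine hcD m (hMD m.2) ?_
    refine commute_of_conj_eq_mul hp hr hpr hD (n := ((m⁻¹ * φ c m : M) : Y))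
      (hMD (SetLike.coe_mem _)) hc
      (mem_centralizer_iff.1 hmem c c.2) ?_
    rw [← hφ]
    simp
  -- reduce to a power
  intro m hm
  refine mem_of_pow_mem_of_isPGroup hp hr hpr hD (hMD hm) ?_
  set F := ((centralizer (E : Set Y)).subgroupOf M).map q with hF
  let A : ℕ → ℕ → E := fun k l => ⟨a ^ k * b ^ l, E.mul_mem (E.pow_mem ha k) (E.pow_mem hb l)⟩
  let g : E → Abelianization M := fun e => q (φ e ⟨m, hm⟩)
  have hmod : ∀ n, b ^ (n % r) = b ^ n := fun n => (pow_eq_pow_mod n hbr).symm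
  have hcomp : ∀ c e : E, Abelianization.map (φ c) (g e) = g (c * e) := by
    intro c e
    change q (φ c (φ e ⟨m, hm⟩)) = q (φ (c * e) ⟨m, hm⟩)
    congr 1
    refine Subtype.ext ?_
    simp [hφ, mul_assoc]
  have hfix : ∀ c e : E, (c : Y) ^ r = 1 →
      (∀ s ∈ D, (c : Y) * s = s * c → s ∈ centralizer (E : Set Y)) →
      ∏ k ∈ Finset.range r, g (c ^ k * e) ∈ F := by
    intro c e hc hcD
    refine hlift c hc hcD _ ?_
    have hcr : c ^ r = 1 := Subtype.ext (by simpa using hc)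
    have hsh := Finset.prod_range_succ' (fun k => g (c ^ k * e)) r
    rw [Finset.prod_range_succ, hcr, pow_zero] at hsh
    rw [map_prod, mul_right_cancel hsh]
    refine Finset.prod_congr rfl fun k _ => ?_
    rw [hcomp, pow_succ', mul_assoc]
  have hA : ∀ k l, A k l = (⟨b, hb⟩ : E) ^ l * ⟨a ^ k, E.pow_mem ha k⟩ := fun k l =>
    Subtype.ext (((show Commute a b from hab).pow_pow k l).eq)
  have hA2 : ∀ j k, A k (j * k) = (A 1 j) ^ k := fun j k => Subtype.ext (by
    have : Commute a (b ^ j) := (show Commute a b from hab).pow_right j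
    simp [A, this.mul_pow, pow_mul])
  have hrow : ∀ k, ∏ l ∈ Finset.range r, g (A k l) ∈ F := by
    intro k
    simp only [hA]
    exact hfix ⟨b, hb⟩ _ hbr h1
  have hdiag : ∀ j, ∏ k ∈ Finset.range r, g (A k (j * k)) ∈ F := by
    intro j
    simp only [hA2]
    have := hfix (A 1 j) 1 ?_ ?_
    · simpa using this
    · have : Commute a (b ^ j) := (show Commute a b from hab).pow_right j
      simp [A, this.mul_pow, har, ← pow_mul, mul_comm j r, pow_mul b r j, hbr]
    · simpa [A] using h2 j
  have hswap : ∏ j ∈ Finset.range r, ∏ k ∈ Finset.range r, g (A k (j * k)) =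
      q ⟨m, hm⟩ ^ r * ∏ k ∈ (Finset.range r).erase 0, ∏ l ∈ Finset.range r, g (A k l) := by
    rw [Finset.prod_comm, ← Finset.mul_prod_erase _ _ (Finset.mem_range.2 hr.pos)]
    congr 1
    · have hg1 : g (A 0 0) = q ⟨m, hm⟩ := by
        change q (φ (A 0 0) ⟨m, hm⟩) = _
        congr 1
        refine Subtype.ext ?_
        simp [hφ, A]
      simp [hg1]
    · refine Finset.prod_congr rfl fun k hk => ?_
      rw [Finset.mem_erase, Finset.mem_range] at hk
      refine prod_range_pow_mul_eq hr (fun l => g (A k l)) (fun n => ?_)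
        (Nat.not_dvd_of_pos_of_lt (Nat.pos_of_ne_zero hk.1) hk.2)
      simp only [A, hmod]
  have hqF : q ⟨m, hm⟩ ^ r ∈ F := by
    have h3 := F.prod_mem (t := Finset.range r) fun j _ => hdiag j
    rw [hswap] at h3
    exact (F.mul_mem_cancel_right (F.prod_mem fun k _ => hrow k)).1 h3
  obtain ⟨f, hf, hfm⟩ := hqF
  have hker : f⁻¹ * ⟨m, hm⟩ ^ r ∈ commutator M := by
    rw [← Abelianization.ker_of, MonoidHom.mem_ker, map_mul, map_inv, map_pow]
    exact inv_mul_eq_one.2 hfm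
  have h4 : ((f⁻¹ * ⟨m, hm⟩ ^ r : M) : Y) ∈ centralizer (E : Set Y) := hM' ⟨_, hker, rfl⟩
  have h5 := (centralizer (E : Set Y)).mul_mem (mem_subgroupOf.1 hf) h4
  simpa using h5

theorem exists_codim_one_centralizer [Finite Y] {p r : ℕ} (hp : p.Prime) (hr : r.Prime)
    (hpr : p ≠ r) {T E : Subgroup Y} (hT : IsPGroup p T)
    (hET : ∀ e ∈ E, ∀ t ∈ T, e * t * e⁻¹ ∈ T) (hEc : ∀ e ∈ E, ∀ f ∈ E, e * f = f * e)
    (hEr : ∀ e ∈ E, e ^ r = 1) (hfaith : ∀ e ∈ E, (∀ t ∈ T, e * t = t * e) → e = 1)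
    (hE : E ≠ ⊥) :
    ∃ t ∈ T, ∃ x ∈ E, x * t ≠ t * x ∧
      ∀ b ∈ E, ∃ k : ℕ, ∃ e ∈ E, e * t = t * e ∧ b = e * x ^ k := by
  have hne : Nonempty {t // t ∈ T ∧ t ∉ centralizer (E : Set Y)} := by
    by_contra hno
    refine hE ((eq_bot_iff_forall _).2 fun e he => hfaith e he fun t ht => ?_)
    by_contra hcon
    exact hno ⟨t, ht, fun h => hcon (mem_centralizer_iff.1 h e he)⟩
  obtain ⟨⟨t, htT, htE⟩, hmax⟩ := Finite.exists_max
    fun t : {t // t ∈ T ∧ t ∉ centralizer (E : Set Y)} =>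
      Nat.card (E ⊓ centralizer {(t : Y)} : Subgroup Y)
  have hmem : ∀ {e s : Y}, e ∈ centralizer {s} ↔ e * s = s * e := fun {e s} => by
    rw [mem_centralizer_singleton_iff]
  obtain ⟨x, hx, hxt⟩ : ∃ x ∈ E, x * t ≠ t * x := by
    by_contra! hcon
    exact htE (mem_centralizer_iff.2 hcon)
  refine ⟨t, htT, x, hx, hxt, ?_⟩
  by_contra! hcon
  obtain ⟨b, hb, hbk⟩ := hcon
  set E₀ := E ⊓ centralizer {t} with hE₀
  set D := T ⊓ centralizer (E₀ : Set Y) with hD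
  have hprop : ∀ c ∈ E, c * t ≠ t * c → ∀ s ∈ D, c * s = s * c → s ∈ centralizer (E : Set Y) := by
    intro c hc hct s hs hcs
    by_contra hsE
    have h1 := hmax ⟨s, hs.1, hsE⟩
    have h2 : E₀ ≤ E ⊓ centralizer {s} := fun e he =>
      ⟨he.1, hmem.2 (mem_centralizer_iff.1 hs.2 e he)⟩
    have h3 := eq_of_le_of_card_ge h2 h1
    have h4 : c ∈ E₀ := by rw [h3]; exact ⟨hc, hmem.2 hcs⟩
    exact hct (hmem.1 h4.2)
  have hx' : ∀ j : ℕ, x * b ^ j * t ≠ t * (x * b ^ j) := by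
    intro j hj
    by_cases hrj : r ∣ j
    · obtain ⟨k, rfl⟩ := hrj
      rw [pow_mul, hEr b hb] at hj
      exact hxt (by simpa using hj)
    · obtain ⟨u, hu⟩ := Nat.exists_mul_mod_eq_one_of_coprime
        ((Nat.Prime.coprime_iff_not_dvd hr).2 hrj).symm hr.one_lt
      have hb1 : b ^ (j * u) = b := by
        rw [pow_eq_pow_mod _ (hEr b hb), hu.2, pow_one]
      have hcx : Commute x (b ^ j) := hEc x hx _ (E.pow_mem hb j)
      refine hbk ((r - 1) * u) ((x * b ^ j) ^ u) (E.pow_mem (E.mul_mem hx (E.pow_mem hb j)) u)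
        ((show Commute (x * b ^ j) t from hj).pow_left u).eq ?_
      have hxr : x ^ u * x ^ ((r - 1) * u) = 1 := by
        have h5 : u + (r - 1) * u = r * u := by
          obtain ⟨m, rfl⟩ := Nat.exists_eq_succ_of_ne_zero hr.ne_zero
          simp; ring
        rw [← pow_add, h5, pow_mul, hEr x hx, one_pow]
      have hcx' : Commute (x ^ u) ((b ^ j) ^ u) := hcx.pow_pow u u
      rw [hcx.mul_pow, hcx'.eq, mul_assoc, hxr, mul_one, ← pow_mul, hb1]
  have hbt : b * t ≠ t * b := fun h => hbk 0 b hb h (by simp)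
  have hED : ∀ e ∈ E, ∀ m ∈ D, e * m * e⁻¹ ∈ D := by
    intro e he m hm
    refine ⟨hET e he m hm.1, mem_centralizer_iff.2 fun f hf => ?_⟩
    have h1 : f * m = m * f := mem_centralizer_iff.1 hm.2 f hf
    have h2 : Commute f e := hEc f hf.1 e he
    exact ((h2.mul_right h1).mul_right h2.inv_right).eq
  have htD : t ∈ D := ⟨htT, mem_centralizer_iff.2 fun e he => hmem.1 he.2⟩
  exact htE (le_centralizer_of_forall_commute hp hr hpr (hT.to_le inf_le_left) hx hb
    (hEc x hx b hb) (hEr x hx) (hEr b hb) (hprop b hb hbt)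
    (fun j => hprop _ (E.mul_mem hx (E.pow_mem hb j)) (hx' j)) _ D rfl le_rfl hED htD)

end CoprimeConj

section CoprimeAction

variable {Y A : Type*} [Group Y] [CommGroup A] [MulDistribMulAction Y A]

theorem eq_bot_of_no_fixed_points [Finite A] {r : ℕ} (hr : r.Prime) (hA : ∀ a : A, a ^ r = 1)
    {P : Subgroup Y} (hP : IsPGroup r P) {W : Subgroup A} (hW : ∀ e ∈ P, ∀ w ∈ W, e • w ∈ W)
    (h : ∀ w ∈ W, (∀ e ∈ P, e • w = w) → w = 1) : W = ⊥ := by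
  have := Fact.mk hr
  by_contra hne
  let act : MulAction P W :=
    { smul := fun e w => ⟨(e : Y) • (w : A), hW e e.2 w w.2⟩
      one_smul := fun w => Subtype.ext (one_smul Y (w : A))
      mul_smul := fun e f w => Subtype.ext (mul_smul (e : Y) (f : Y) (w : A)) }
  have hWr : IsPGroup r W := fun w => ⟨1, Subtype.ext (by simpa using hA w)⟩
  obtain ⟨n, hn⟩ := IsPGroup.iff_card.1 hWr
  have hdvd : r ∣ Nat.card W := by
    rw [hn]
    refine dvd_pow_self r fun h0 => hne ?_
    rw [h0, pow_zero] at hn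
    exact Subgroup.card_eq_one.1 hn
  obtain ⟨w, hw, hw1⟩ := hP.exists_fixed_point_of_prime_dvd_card_of_fixed_point W hdvd
    (a := (1 : W)) (fun e => Subtype.ext (smul_one (e : Y)))
  refine hw1 (Subtype.ext (h w w.2 fun e he => ?_).symm)
  exact congrArg Subtype.val (hw ⟨e, he⟩)

theorem eq_one_of_pow_coprime {r m : ℕ} (hm : m.Coprime r) {a : A} (h1 : a ^ r = 1)
    (h2 : a ^ m = 1) : a = 1 :=
  orderOf_eq_one_iff.1 (Nat.eq_one_of_dvd_coprimes hm (orderOf_dvd_of_pow_eq_one h2)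
    (orderOf_dvd_of_pow_eq_one h1))

/-- A coprime element that moves `u` by something it fixes, fixes `u`. -/
theorem smul_eq_of_smul_eq_mul {r m : ℕ} (hA : ∀ a : A, a ^ r = 1) (hm : m.Coprime r) {y : Y}
    (hy : y ^ m = 1) {u f : A} (hu : y • u = u * f) (hf : y • f = f) : y • u = u := by
  have key : ∀ k : ℕ, y ^ k • u = u * f ^ k := by
    intro k
    induction k with
    | zero => simp
    | succ k ih => rw [pow_succ', mul_smul, ih, smul_mul', smul_pow', hu, hf, pow_succ', mul_assoc]
  have h1 := key m
  rw [hy, one_smul] at h1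
  have h2 : f = 1 := eq_one_of_pow_coprime hm (hA f) (by simpa using h1.symm)
  rw [hu, h2, mul_one]

/-- A special case of Thompson's `A × B` lemma. -/
theorem smul_eq_of_forall_fixed [Finite A] {r m : ℕ} (hr : r.Prime) (hA : ∀ a : A, a ^ r = 1)
    (hm : m.Coprime r) {P : Subgroup Y} (hP : IsPGroup r P) {y : Y} (hy : y ^ m = 1)
    (hyP : ∀ e ∈ P, e * y = y * e) (h : ∀ v : A, (∀ e ∈ P, e • v = v) → y • v = v) (v : A) :
    y • v = v := by
  let N : A →* A := ∏ k ∈ Finset.range m, MulDistribMulAction.toMonoidHom A (y ^ k)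
  have hN : ∀ v, N v = ∏ k ∈ Finset.range m, y ^ k • v := fun v => by
    simp [N, MonoidHom.finsetProd_apply]
  have hyk : ∀ e ∈ P, ∀ k : ℕ, e * y ^ k = y ^ k * e := fun e he k =>
    ((show Commute e y from hyP e he).pow_right k).eq
  have hker : N.ker = ⊥ := by
    refine eq_bot_of_no_fixed_points hr hA hP ?_ ?_
    · intro e he w hw
      rw [MonoidHom.mem_ker, hN] at hw ⊢
      have : ∏ k ∈ Finset.range m, y ^ k • e • w = e • ∏ k ∈ Finset.range m, y ^ k • w := by
        rw [Finset.smul_prod']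
        refine Finset.prod_congr rfl fun k _ => ?_
        rw [← mul_smul, ← mul_smul, hyk e he]
      rw [this, hw, smul_one]
    · intro w hw hfix
      rw [MonoidHom.mem_ker, hN] at hw
      have h1 := h w hfix
      have h2 : ∀ k : ℕ, y ^ k • w = w := by
        intro k
        induction k with
        | zero => simp
        | succ k ih => rw [pow_succ, mul_smul, h1, ih]
      simp only [h2, Finset.prod_const, Finset.card_range] at hw
      exact eq_one_of_pow_coprime hm (hA w) hw
  have hmem : (y • v) / v ∈ N.ker := by
    rw [MonoidHom.mem_ker, map_div, hN, hN, div_eq_one]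
    have hsh := Finset.prod_range_succ' (fun k => y ^ k • v) m
    rw [Finset.prod_range_succ, hy, pow_zero] at hsh
    rw [mul_right_cancel hsh]
    refine Finset.prod_congr rfl fun k _ => ?_
    rw [pow_succ, mul_smul]
  rw [hker, mem_bot, div_eq_one] at hmem
  exact hmem

theorem inv_smul_eq_mul_inv {x : Y} {u f : A} (hx : x • u = u * f) (hf : x • f = f) :
    x⁻¹ • u = u * f⁻¹ := by
  rw [inv_smul_eq_iff, smul_mul', smul_inv', hx, hf, mul_inv_cancel_right]

theorem smul_eq_of_transvections {r m : ℕ} (hA : ∀ a : A, a ^ r = 1) (hm : m.Coprime r)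
    {x x' : Y} (hy : (x⁻¹ * x') ^ m = 1) {v w : A} (hxv : x • v = v) (hxw : x' • w = w)
    {c : ℕ} (hv : x' • v = v * w ^ c) (hw : x • w = w) {u : A} {k l : ℕ} (hu : x • u = u * v ^ k)
    (hu' : x' • u = u * w ^ l) : (x⁻¹ * x') • u = u := by
  have hw' : x⁻¹ • w = w := by rw [inv_smul_eq_iff, hw]
  have hv' : x⁻¹ • v = v := by rw [inv_smul_eq_iff, hxv]
  have hyw : (x⁻¹ * x') • w = w := by rw [mul_smul, hxw, hw']
  have hyv : (x⁻¹ * x') • v = v := by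
    refine smul_eq_of_smul_eq_mul hA hm hy (f := w ^ c) ?_ ?_
    · rw [mul_smul, hv, smul_mul', smul_pow', hv', hw']
    · rw [smul_pow', hyw]
  refine smul_eq_of_smul_eq_mul hA hm hy (f := (v ^ k)⁻¹ * w ^ l) ?_ ?_
  · rw [mul_smul, hu', smul_mul', smul_pow', hw',
      inv_smul_eq_mul_inv hu (by rw [smul_pow', hxv]), mul_assoc]
  · rw [smul_mul', smul_inv', smul_pow', smul_pow', hyv, hyw]

theorem pow_zmod_val_add {r : ℕ} [NeZero r] {v : A} (hv : v ^ r = 1) (a b : ZMod r) :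
    v ^ (a + b).val = v ^ a.val * v ^ b.val := by
  rw [ZMod.val_add, ← pow_eq_pow_mod _ hv, pow_add]

theorem pow_zmod_val_mul {r : ℕ} [NeZero r] {v : A} (hv : v ^ r = 1) (a b : ZMod r) :
    v ^ (a * b).val = (v ^ a.val) ^ b.val := by
  rw [ZMod.val_mul, ← pow_eq_pow_mod _ hv, pow_mul]

theorem pow_zmod_val_eq_one {r : ℕ} (hr : r.Prime) {v : A} (hv : v ^ r = 1) (h1 : v ≠ 1)
    {a : ZMod r} (h : v ^ a.val = 1) : a = 0 := by
  have := Fact.mk hr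
  have ho := orderOf_eq_prime hv h1
  rw [← ZMod.val_eq_zero]
  have hd := orderOf_dvd_of_pow_eq_one h
  rw [ho] at hd
  exact Nat.eq_zero_of_dvd_of_lt hd (ZMod.val_lt a)

theorem sq_sub_one_dvd_card_closure {r : ℕ} (hr : r.Prime) (hA : ∀ a : A, a ^ r = 1)
    {x x' : Y} {v w : A} (hxv : x • v = v) (hxw : x' • w = w) {c c' : ℕ}
    (hv : x' • v = v * w ^ c') (hw : x • w = w * v ^ c) (hc : v ^ c ≠ 1) (hc' : w ^ c' ≠ 1) :
    r * r - 1 ∣ Nat.card (closure {x, x'}) := by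
  have := Fact.mk hr
  have hv1 : v ≠ 1 := fun h => hc (by rw [h, one_pow])
  have hw1 : w ≠ 1 := fun h => hc' (by rw [h, one_pow])
  have hcast : ∀ (z : A) (n : ℕ), z ^ ((n : ZMod r)).val = z ^ n := fun z n => by
    rw [ZMod.val_natCast, ← pow_eq_pow_mod _ (hA z)]
  have hc0 : (c : ZMod r) ≠ 0 := fun h => hc (by rw [← hcast, h, ZMod.val_zero, pow_zero])
  have hc0' : (c' : ZMod r) ≠ 0 := fun h => hc' (by rw [← hcast, h, ZMod.val_zero, pow_zero])
  let f : ZMod r → ZMod r → A := fun a b => v ^ a.val * w ^ b.val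
  have hx : ∀ a b, x • f a b = f (a + c * b) b := by
    intro a b
    simp only [f]
    rw [smul_mul', smul_pow', smul_pow', hxv, hw, pow_zmod_val_add (hA v), pow_zmod_val_mul (hA v),
      hcast, mul_pow]
    rw [mul_assoc, mul_comm ((v ^ c) ^ b.val)]
  have hx' : ∀ a b, x' • f a b = f a (b + c' * a) := by
    intro a b
    simp only [f]
    rw [smul_mul', smul_pow', smul_pow', hxw, hv, pow_zmod_val_add (hA w), pow_zmod_val_mul (hA w),
      hcast, mul_pow]
    rw [mul_assoc, mul_comm (w ^ b.val)]
  have hadd : ∀ a b a' b', f (a + a') (b + b') = f a b * f a' b' := by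
    intro a b a' b'
    simp only [f]
    rw [pow_zmod_val_add (hA v), pow_zmod_val_add (hA w)]
    exact mul_mul_mul_comm _ _ _ _
  have hone : ∀ a b, f a b = 1 → a = 0 ∧ b = 0 := by
    intro a b hab
    have h1 : f (a + c * b) b = 1 := by rw [← hx, hab, smul_one]
    have h2 : f (a + c * b) b = f a b * f (c * b) 0 := by rw [← hadd, add_zero]
    rw [h1, hab, one_mul] at h2
    have h3 : v ^ ((c : ZMod r) * b).val = 1 := by simpa [f] using h2.symm
    have h4 : b = 0 := (mul_eq_zero.1 (pow_zmod_val_eq_one hr (hA v) hv1 h3)).resolve_left hc0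
    subst h4
    exact ⟨pow_zmod_val_eq_one hr (hA v) hv1 (by simpa [f] using hab), rfl⟩
  let F : ZMod r × ZMod r → A := fun s => f s.1 s.2
  have hF : Function.Injective F := by
    rintro ⟨a, b⟩ ⟨a', b'⟩ h
    have h1 : f a b = f a' b' * f (a - a') (b - b') := by rw [← hadd]; congr 1 <;> ring
    have h2 := hone _ _ (mul_left_cancel (a := f a' b') (by rw [mul_one, ← h1]; exact h))
    exact Prod.ext (sub_eq_zero.1 h2.1) (sub_eq_zero.1 h2.2)
  have hinv : ∀ g ∈ closure {x, x'}, ∀ s, (∃ s', g • F s = F s') ∧ ∃ s', g⁻¹ • F s = F s' := by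
    intro g hg
    induction hg using closure_induction with
    | mem g hg =>
      rintro ⟨a, b⟩
      rcases hg with rfl | rfl
      · refine ⟨⟨(_, _), hx a b⟩, ⟨(a - c * b, b), ?_⟩⟩
        rw [inv_smul_eq_iff]
        exact (show f a b = f (a - c * b + c * b) b by rw [sub_add_cancel]).trans (hx _ _).symm
      · refine ⟨⟨(_, _), hx' a b⟩, ⟨(a, b - c' * a), ?_⟩⟩
        rw [inv_smul_eq_iff]
        exact (show f a b = f a (b - c' * a + c' * a) by rw [sub_add_cancel]).trans (hx' _ _).symm
    | one => exact fun s => ⟨⟨s, one_smul _ _⟩, ⟨s, by simp⟩⟩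
    | mul g h _ _ ihg ihh =>
      intro s
      obtain ⟨s1, h1⟩ := (ihh s).1
      obtain ⟨s2, h2⟩ := (ihg s1).1
      obtain ⟨s3, h3⟩ := (ihg s).2
      obtain ⟨s4, h4⟩ := (ihh s3).2
      exact ⟨⟨s2, by rw [mul_smul, h1, h2]⟩, ⟨s4, by rw [mul_inv_rev, mul_smul, h3, h4]⟩⟩
    | inv g _ ih => exact fun s => ⟨(ih s).2, by rw [inv_inv]; exact (ih s).1⟩
  have hxpow : ∀ (k : ℕ) a b, x ^ k • f a b = f (a + k * (c * b)) b := by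
    intro k a b
    induction k with
    | zero => simp
    | succ k ih => rw [pow_succ', mul_smul, ih, hx]; congr 1; push_cast; ring
  have hxpow' : ∀ (k : ℕ) a b, x' ^ k • f a b = f a (b + k * (c' * a)) := by
    intro k a b
    induction k with
    | zero => simp
    | succ k ih => rw [pow_succ', mul_smul, ih, hx']; congr 1; push_cast; ring
  set S := closure {x, x'} with hS
  have hxS : x ∈ S := subset_closure (by simp)
  have hxS' : x' ∈ S := subset_closure (by simp)
  have hmove : ∀ a b a', b ≠ 0 → ∃ g ∈ S, g • f a b = f a' b := by
    intro a b a' hb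
    refine ⟨x ^ ((a' - a) / (c * b)).val, S.pow_mem hxS _, ?_⟩
    rw [hxpow]
    congr 1
    rw [ZMod.natCast_zmod_val, div_mul_cancel₀ _ (mul_ne_zero hc0 hb)]
    ring
  have hmove' : ∀ a b b', a ≠ 0 → ∃ g ∈ S, g • f a b = f a b' := by
    intro a b b' ha
    refine ⟨x' ^ ((b' - b) / (c' * a)).val, S.pow_mem hxS' _, ?_⟩
    rw [hxpow']
    congr 1
    rw [ZMod.natCast_zmod_val, div_mul_cancel₀ _ (mul_ne_zero hc0' ha)]
    ring
  have horb : MulAction.orbit S (F (1, 0)) = F '' {0}ᶜ := by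
    ext z
    constructor
    · rintro ⟨⟨g, hg⟩, rfl⟩
      obtain ⟨s', hs'⟩ := (hinv g hg (1, 0)).1
      refine ⟨s', ?_, hs'.symm⟩
      rintro rfl
      have h0 : F 0 = 1 := by simp [F, f]
      rw [h0, smul_eq_iff_eq_inv_smul, smul_one] at hs'
      exact one_ne_zero (hone _ _ hs').1
    · rintro ⟨⟨a, b⟩, hab, rfl⟩
      by_cases hb : b = 0
      · have ha : a ≠ 0 := fun ha => hab (by rw [ha, hb]; rfl)
        obtain ⟨g1, hg1, h1⟩ := hmove' 1 0 1 one_ne_zero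
        obtain ⟨g2, hg2, h2⟩ := hmove 1 1 a one_ne_zero
        obtain ⟨g3, hg3, h3⟩ := hmove' a 1 b ha
        refine ⟨⟨g3 * (g2 * g1), S.mul_mem hg3 (S.mul_mem hg2 hg1)⟩, ?_⟩
        change (g3 * (g2 * g1)) • f 1 0 = f a b
        rw [mul_smul, mul_smul, h1, h2, h3]
      · obtain ⟨g1, hg1, h1⟩ := hmove' 1 0 b one_ne_zero
        obtain ⟨g2, hg2, h2⟩ := hmove 1 b a hb
        refine ⟨⟨g2 * g1, S.mul_mem hg2 hg1⟩, ?_⟩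
        change (g2 * g1) • f 1 0 = f a b
        rw [mul_smul, h1, h2]
  have hcard : (MulAction.orbit S (F (1, 0))).ncard = r * r - 1 := by
    rw [horb, Set.ncard_image_of_injective _ hF, Set.ncard_compl, Set.ncard_singleton]
    simp
  rw [← hcard, ← MulAction.index_stabilizer]
  exact index_dvd_card _

theorem not_sq_sub_one_dvd {p r k : ℕ} (hp : p.Prime) (hr : r.Prime) (hpr : p ≠ r)
    (h1 : ¬ (p = 2 ∧ r = 3)) (h2 : ¬ (p = 3 ∧ r = 2)) : ¬ r * r - 1 ∣ r * p ^ k := by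
  intro hd
  have hpos : 1 ≤ r * r := Nat.mul_pos hr.pos hr.pos
  have key : ∀ q : ℕ, q.Prime → q ∣ r * r - 1 → q = p := by
    intro q hq hqd
    rcases hq.dvd_mul.1 (hqd.trans hd) with h | h
    · have hq1 := (Nat.dvd_sub_iff_right hpos (h.mul_right r)).1 hqd
      exact absurd (Nat.dvd_one.1 hq1) hq.ne_one
    · exact (Nat.prime_dvd_prime_iff_eq hq hp).1 (hq.dvd_of_dvd_pow h)
  by_cases hr2 : r = 2
  · subst hr2
    exact h2 ⟨(key 3 Nat.prime_three (by norm_num)).symm, rfl⟩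
  have hodd := hr.eq_two_or_odd.resolve_left hr2
  have hp2 : 2 = p := by
    refine key 2 Nat.prime_two ((Nat.modEq_iff_dvd' hpos).1 ?_)
    simp [Nat.ModEq, Nat.mul_mod, hodd]
  by_cases hr3 : r = 3
  · exact h1 ⟨hp2.symm, hr3⟩
  have hmod : r % 3 ≠ 0 := fun h0 =>
    hr3 ((Nat.prime_dvd_prime_iff_eq Nat.prime_three hr).1 (Nat.dvd_of_mod_eq_zero h0)).symm
  have hp3 : 3 = p := by
    refine key 3 Nat.prime_three ((Nat.modEq_iff_dvd' hpos).1 ?_)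
    have h3 : r % 3 = 1 ∨ r % 3 = 2 := by omega
    rcases h3 with h3 | h3 <;> simp [Nat.ModEq, Nat.mul_mod, h3]
  omega

/-- The fixed points in `A` of a subgroup. -/
def fixedSubgroup (A : Type*) [CommGroup A] [MulDistribMulAction Y A] (P : Subgroup Y) :
    Subgroup A where
  carrier := {a | ∀ e ∈ P, e • a = a}
  mul_mem' ha hb e he := by rw [smul_mul', ha e he, hb e he]
  one_mem' e _ := smul_one e
  inv_mem' ha e he := by rw [smul_inv', ha e he]

/-- Outside the exceptional pairs of primes, an elementary abelian `r`-group acting faithfully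
on a normal `p`-subgroup is not an offender on an elementary abelian `r`-group. -/
theorem no_offender [Finite Y] [Finite A] [FaithfulSMul Y A] {p r : ℕ} (hp : p.Prime)
    (hr : r.Prime) (hpr : p ≠ r) (hbad1 : ¬ (p = 2 ∧ r = 3)) (hbad2 : ¬ (p = 3 ∧ r = 2))
    (hA : ∀ a : A, a ^ r = 1) {T E : Subgroup Y} (hTn : T.Normal) (hT : IsPGroup p T)
    (hEc : ∀ e ∈ E, ∀ f ∈ E, e * f = f * e) (hEr : ∀ e ∈ E, e ^ r = 1)
    (hfaith : ∀ e ∈ E, (∀ t ∈ T, e * t = t * e) → e = 1) (hE : E ≠ ⊥)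
    (hoff : ∀ E₀ ≤ E, Nat.card E₀ * Nat.card (fixedSubgroup A E₀) ≤
      Nat.card E * Nat.card (fixedSubgroup A E)) : False := by
  have := Fact.mk hr
  have := Fact.mk hp
  obtain ⟨t, ht, x, hx, hxt, hgen⟩ := exists_codim_one_centralizer hp hr hpr hT
    (fun e _ t ht => hTn.conj_mem t ht e) hEc hEr hfaith hE
  set E₀ := E ⊓ centralizer {t} with hE₀
  have hE₀t : ∀ e ∈ E₀, e * t = t * e := fun e he => mem_centralizer_singleton_iff.1 he.2
  have hE₀x : ∀ e ∈ E₀, e * x = x * e := fun e he => hEc e he.1 x hx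
  set V := fixedSubgroup A E₀ with hV
  have hVinv : ∀ g : Y, (∀ e ∈ E₀, e * g = g * e) → ∀ u ∈ V, g • u ∈ V := by
    intro g hg u hu e he
    rw [← mul_smul, hg e he, mul_smul, hu e he]
  have hcardE : Nat.card E ≤ Nat.card E₀ * r := by
    let f : E₀ × Fin r → E := fun s => ⟨s.1 * x ^ (s.2 : ℕ), E.mul_mem s.1.2.1 (E.pow_mem hx _)⟩
    have hf : Function.Surjective f := by
      rintro ⟨b, hb⟩
      obtain ⟨k, e, he, het, rfl⟩ := hgen b hb
      refine ⟨(⟨e, he, mem_centralizer_singleton_iff.2 het⟩, ⟨k % r, Nat.mod_lt _ hr.pos⟩),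
        Subtype.ext ?_⟩
      simp only [f]
      rw [← pow_eq_pow_mod _ (hEr x hx)]
    have := Nat.card_le_card_of_surjective f hf
    simpa [Nat.card_prod] using this
  have hcardV : Nat.card V ≤ r * Nat.card (fixedSubgroup A E) := by
    have h1 := hoff E₀ inf_le_left
    have h2 : 0 < Nat.card E₀ := Nat.card_pos
    refine Nat.le_of_mul_le_mul_left (h1.trans ?_) h2
    rw [← mul_assoc]
    exact Nat.mul_le_mul_right _ hcardE
  -- the conjugate of `x` by `t`, and its quotient by `x`
  set x' := t⁻¹ * x * t with hx'
  have hyT : x⁻¹ * x' ∈ T := by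
    have := T.mul_mem (hTn.conj_mem _ (T.inv_mem ht) x⁻¹) ht
    simpa [hx', mul_assoc] using this
  obtain ⟨k, hk⟩ := hT ⟨_, hyT⟩
  have hy : (x⁻¹ * x') ^ p ^ k = 1 := by simpa using congrArg Subtype.val hk
  have hm : (p ^ k).Coprime r := Nat.Coprime.pow_left _ ((Nat.coprime_primes hp hr).2 hpr)
  have hE₀p : IsPGroup r E₀ := fun e => ⟨1, Subtype.ext (by simpa using hEr e e.2.1)⟩
  have hend : ¬ ∀ u ∈ V, (x⁻¹ * x') • u = u := by
    intro hall
    have hy1 : x⁻¹ * x' = 1 := by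
      refine FaithfulSMul.eq_of_smul_eq_smul (α := A) fun v => ?_
      rw [one_smul]
      refine smul_eq_of_forall_fixed hr hA hm hE₀p hy (fun e he => ?_) hall v
      have c1 : Commute e x := hE₀x e he
      have c2 : Commute e t := hE₀t e he
      exact (c1.inv_right.mul_right ((c2.inv_right.mul_right c1).mul_right c2)).eq
    rw [inv_mul_eq_one, hx', mul_assoc, eq_inv_mul_iff_mul_eq] at hy1
    exact hxt hy1.symm
  -- the commutator map with `x`
  let δ : V →* A :=
    { toFun := fun u => (x • (u : A)) / u
      map_one' := by simp
      map_mul' := fun a b => by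
        simp only [Subgroup.coe_mul, smul_mul']
        rw [mul_div_mul_comm] }
  have hδ : ∀ u : V, x • (u : A) = u * δ u := fun u => (mul_div_cancel _ _).symm
  have hrange : Nat.card δ.range ≤ r := by
    have h1 : Nat.card δ.ker = Nat.card (fixedSubgroup A E) := by
      rw [← card_map_of_injective' V.subtype V.subtype_injective]
      congr 2
      ext u
      constructor
      · rintro ⟨u, hu, rfl⟩ b hb
        have hxu : x • (u : A) = u := by rw [hδ, MonoidHom.mem_ker.1 hu, mul_one]
        obtain ⟨k, e, he, het, rfl⟩ := hgen b hb
        have hxk : ∀ k : ℕ, x ^ k • (u : A) = u := by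
          intro k
          induction k with
          | zero => simp
          | succ k ih => rw [pow_succ, mul_smul, hxu, ih]
        rw [mul_smul]
        exact (congrArg _ (hxk k)).trans (u.2 e ⟨he, mem_centralizer_singleton_iff.2 het⟩)
      · intro hu
        refine ⟨⟨u, fun e he => hu e he.1⟩, ?_, rfl⟩
        exact div_eq_one.2 (hu x hx)
    have h2 : Nat.card δ.ker * Nat.card δ.range = Nat.card V := by
      rw [← index_ker, card_mul_index]
    have h3 : 0 < Nat.card δ.ker := Nat.card_pos
    rw [← h1, ← h2, mul_comm r] at hcardV
    exact Nat.le_of_mul_le_mul_left hcardV h3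
  have hrangeV : δ.range ≤ V := by
    rintro _ ⟨u, rfl⟩
    exact V.div_mem (hVinv x hE₀x u u.2) u.2
  have hnt : ∃ v ∈ δ.range, x • v = v ∧ v ≠ 1 := by
    by_contra! hcon
    have hbot : δ.range = ⊥ := by
      refine eq_bot_of_no_fixed_points (P := zpowers x) hr hA ?_ ?_ ?_
      · rw [IsPGroup.iff_card]
        rcases (Nat.dvd_prime hr).1 (orderOf_dvd_of_pow_eq_one (hEr x hx)) with h | h
        · exact ⟨0, by rw [Nat.card_zpowers, h, pow_zero]⟩
        · exact ⟨1, by rw [Nat.card_zpowers, h, pow_one]⟩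
      · rintro e he _ ⟨u, rfl⟩
        have hex : e * x = x * e := by
          obtain ⟨k, rfl⟩ := mem_zpowers_iff.1 he
          exact ((Commute.refl x).zpow_left k).eq
        have heE : e ∈ E := (zpowers_le.2 hx) he
        refine ⟨⟨e • (u : A), hVinv e (fun f hf => hEc f hf.1 e heE) u u.2⟩, ?_⟩
        change x • e • (u : A) / e • (u : A) = e • (x • (u : A) / u)
        rw [smul_div', ← mul_smul, ← mul_smul, hex]
      · intro w hw hfix
        exact hcon w hw (hfix x (mem_zpowers x))
    have hxV : ∀ u ∈ V, x • u = u := by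
      intro u hu
      have h1 : δ ⟨u, hu⟩ ∈ δ.range := ⟨_, rfl⟩
      rw [hbot, mem_bot] at h1
      have h2 := hδ ⟨u, hu⟩
      rwa [h1, mul_one] at h2
    refine hend fun u hu => ?_
    rw [hx', mul_smul, mul_smul, mul_smul, hxV _ (hVinv t hE₀t u hu), inv_smul_smul,
      inv_smul_eq_iff,
      hxV u hu]
  obtain ⟨v, hvr, hxv, hv1⟩ := hnt
  have hzp : δ.range = zpowers v := by
    refine (eq_of_le_of_card_ge (zpowers_le.2 hvr) ?_).symm
    rwa [Nat.card_zpowers, orderOf_eq_prime (hA v) hv1]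
  have hxu : ∀ u ∈ V, ∃ k : ℕ, x • u = u * v ^ k := by
    intro u hu
    have h1 : δ ⟨u, hu⟩ ∈ zpowers v := hzp ▸ ⟨_, rfl⟩
    obtain ⟨k, hk⟩ := mem_powers_iff_mem_zpowers.2 h1
    exact ⟨k, by rw [show v ^ k = δ ⟨u, hu⟩ from hk]; exact hδ ⟨u, hu⟩⟩
  set w := t⁻¹ • v with hw
  have hvV := hrangeV hvr
  have hwV : w ∈ V := hVinv t⁻¹ (fun e he => (show Commute e t from hE₀t e he).inv_right.eq) v hvV
  have hxu' : ∀ u ∈ V, ∃ k : ℕ, x' • u = u * w ^ k := by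
    intro u hu
    obtain ⟨k, hk⟩ := hxu _ (hVinv t hE₀t u hu)
    refine ⟨k, ?_⟩
    rw [hx', mul_smul, mul_smul, hk, smul_mul', inv_smul_smul, smul_pow']
  have hxw : x' • w = w := by rw [hx', hw, mul_smul, mul_smul, smul_inv_smul, hxv]
  obtain ⟨c, hc⟩ := hxu w hwV
  obtain ⟨c', hc'⟩ := hxu' v hvV
  by_cases h1 : v ^ c = 1
  · refine hend fun u hu => ?_
    obtain ⟨k, hk⟩ := hxu u hu
    obtain ⟨l, hl⟩ := hxu' u hu
    exact smul_eq_of_transvections hA hm hy hxv hxw hc' (by rw [hc, h1, mul_one]) hk hl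
  by_cases h2 : w ^ c' = 1
  · refine hend fun u hu => ?_
    obtain ⟨k, hk⟩ := hxu u hu
    obtain ⟨l, hl⟩ := hxu' u hu
    have hinv : x'⁻¹ * x = (x⁻¹ * x')⁻¹ := by simp
    have := smul_eq_of_transvections hA hm (x := x') (x' := x)
      (by rw [hinv, inv_pow, hy, inv_one]) hxw hxv hc (by rw [hc', h2, mul_one]) hl hk
    rwa [hinv, inv_smul_eq_iff, eq_comm] at this
  have hd := sq_sub_one_dvd_card_closure hr hA hxv hxw hc' hc h1 h2
  obtain ⟨n, hn⟩ := IsPGroup.iff_card.1 hT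
  refine not_sq_sub_one_dvd (k := n) hp hr hpr hbad1 hbad2 (hd.trans ?_)
  have hle : closure {x, x'} ≤ zpowers x ⊔ T := by
    rw [closure_le]
    rintro g (rfl | rfl)
    · exact mem_sup_left (mem_zpowers _)
    · have := (zpowers x ⊔ T).mul_mem (mem_sup_left (mem_zpowers x)) (mem_sup_right hyT)
      rwa [mul_inv_cancel_left] at this
  refine (card_dvd_of_le hle).trans ((card_sup_dvd _ _).trans ?_)
  rw [hn, Nat.card_zpowers]
  exact Nat.mul_dvd_mul_right (orderOf_dvd_of_pow_eq_one (hEr x hx)) _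

end CoprimeAction

section CoveringHeight

variable {α : Type*} [Lattice α] [IsModularLattice α] [Finite α]

theorem height_ne_top_of_finite {β : Type*} [PartialOrder β] [Finite β] (b : β) :
    Order.height b ≠ ⊤ := by
  intro h
  rw [Order.height_eq_top_iff] at h
  obtain ⟨s, -, hs⟩ := h (Nat.card β)
  have h1 := Nat.card_le_card_of_injective s s.strictMono.injective
  rw [Nat.card_fin] at h1
  omega

theorem height_eq_of_covBy : ∀ {b a : α}, a ⋖ b → Order.height b = Order.height a + 1 := by
  intro b
  induction b using WellFoundedLT.induction with
  | ind b ih =>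
    intro a hab
    apply le_antisymm _ (Order.height_add_one_le hab.lt)
    obtain ⟨n, hn⟩ := ENat.ne_top_iff_exists.1 (height_ne_top_of_finite a)
    rw [← hn]
    have : ((n : ℕ∞) + 1) = ((n + 1 : ℕ) : ℕ∞) := by push_cast; rfl
    rw [this, Order.height_le_coe_iff]
    intro d hd
    by_cases hda : d ≤ a
    · refine lt_of_le_of_lt (Order.height_mono hda) ?_
      rw [← hn]
      exact_mod_cast Nat.lt_succ_self n
    · have hsup : d ⊔ a = b := by
        rcases hab.eq_or_eq (c := d ⊔ a) le_sup_right (sup_le hd.le hab.le) with h | h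
        · exact absurd (h ▸ le_sup_left) hda
        · exact h
      have hc : d ⊓ a ⋖ d := by
        apply inf_covBy_of_covBy_sup_right
        rw [hsup]; exact hab
      have hlt : d ⊓ a < a := by
        refine lt_of_le_of_ne inf_le_right fun h => ?_
        have : a ≤ d := by rw [← h]; exact inf_le_left
        rw [sup_eq_left.2 this] at hsup
        exact hd.ne hsup
      rw [ih d hd hc]
      have h3 := Order.height_add_one_le hlt
      refine lt_of_le_of_lt h3 ?_
      rw [← hn]
      exact_mod_cast Nat.lt_succ_self n

end CoveringHeight

section NormalSubgroupLattice

variable {G : Type*} [Group G]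

theorem exists_mul_of_mem_sup {N M : Subgroup G} (h : ∀ x ∈ N, ∀ y ∈ M, x * y * x⁻¹ ∈ M)
    {g : G} (hg : g ∈ N ⊔ M) : ∃ x ∈ N, ∃ y ∈ M, x * y = g := by
  have hle : N ≤ normalizer (M : Set G) := by
    intro x hx
    rw [mem_normalizer_iff]
    intro y
    refine ⟨h x hx y, fun hy => ?_⟩
    have := h x⁻¹ (inv_mem hx) _ hy
    simpa [mul_assoc] using this
  have h2 : g ∈ ((N ⊔ M : Subgroup G) : Set G) := hg
  rw [Subgroup.coe_mul_of_left_le_normalizer_right N M hle] at h2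
  exact Set.mem_mul.1 h2

/-- `N` is a normal subgroup of the subgroup `K`. -/
def IsNormalIn (K N : Subgroup G) : Prop :=
  N ≤ K ∧ ∀ k ∈ K, ∀ n ∈ N, k * n * k⁻¹ ∈ N

theorem IsNormalIn.sup {K N M : Subgroup G} (hN : IsNormalIn K N) (hM : IsNormalIn K M) :
    IsNormalIn K (N ⊔ M) := by
  refine ⟨sup_le hN.1 hM.1, fun k hk n hn => ?_⟩
  obtain ⟨x, hx, y, hy, rfl⟩ := exists_mul_of_mem_sup (fun x hx => hM.2 x (hN.1 hx)) hn
  have : k * (x * y) * k⁻¹ = (k * x * k⁻¹) * (k * y * k⁻¹) := by group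
  rw [this]
  exact mul_mem (mem_sup_left (hN.2 k hk x hx)) (mem_sup_right (hM.2 k hk y hy))

theorem IsNormalIn.inf {K N M : Subgroup G} (hN : IsNormalIn K N) (hM : IsNormalIn K M) :
    IsNormalIn K (N ⊓ M) :=
  ⟨inf_le_left.trans hN.1, fun k hk n hn => ⟨hN.2 k hk n hn.1, hM.2 k hk n hn.2⟩⟩

theorem IsNormalIn.mono {K L N : Subgroup G} (hN : IsNormalIn L N) (hKL : K ≤ L) (hNK : N ≤ K) :
    IsNormalIn K N :=
  ⟨hNK, fun k hk n hn => hN.2 k (hKL hk) n hn⟩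

theorem isNormalIn_inf_of_normal (K X : Subgroup G) [hX : X.Normal] : IsNormalIn K (K ⊓ X) :=
  ⟨inf_le_left, fun k hk n hn =>
    ⟨K.mul_mem (K.mul_mem hk hn.1) (K.inv_mem hk), hX.conj_mem n hn.2 k⟩⟩

/-- The type of normal subgroups of `K`. -/
abbrev NormalIn (K : Subgroup G) := {N : Subgroup G // IsNormalIn K N}

instance (K : Subgroup G) : Lattice (NormalIn K) :=
  Subtype.lattice (fun _ _ => IsNormalIn.sup) (fun _ _ => IsNormalIn.inf)

instance (K : Subgroup G) : IsModularLattice (NormalIn K) where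
  sup_inf_le_assoc_of_le := by
    rintro ⟨x, hx⟩ ⟨y, hy⟩ ⟨z, hz⟩ hxz
    replace hxz : x ≤ z := hxz
    change (x ⊔ y) ⊓ z ≤ x ⊔ y ⊓ z
    intro g hg
    obtain ⟨hg1, hg2⟩ := mem_inf.1 hg
    obtain ⟨a, ha, b, hb, rfl⟩ := exists_mul_of_mem_sup (fun a ha => hy.2 a (hx.1 ha)) hg1
    have hbz : b ∈ z := by
      have := mul_mem (inv_mem (show a ∈ z from hxz ha)) hg2
      simpa using this
    exact mul_mem (mem_sup_left (T := y ⊓ z) ha) (mem_sup_right (S := x) ⟨hb, hbz⟩)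

/-- The length of a longest chain of normal subgroups of `K` ending in `N`. -/
noncomputable def normalHeight (K N : Subgroup G) (h : IsNormalIn K N) : ℕ∞ :=
  Order.height (⟨N, h⟩ : NormalIn K)

end NormalSubgroupLattice

section NormalHeight

variable {G : Type*} [Group G]

/-- In a nilpotent subgroup `P`, a set `S` not contained in `D` has an element outside `D` all
of whose commutators with `P` avoid `S ∖ D`. -/
theorem exists_commutator_descent {P : Subgroup G} (hP : Group.IsNilpotent P) {S D : Subgroup G}
    (hSP : S ≤ P) (hSD : ¬ S ≤ D) :
    ∃ n ∈ S, n ∉ D ∧ ∀ x ∈ P, ∀ y ∈ P, (∃ e : ℤ, y = n ^ e) →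
      x * y * x⁻¹ * y⁻¹ ∈ S → x * y * x⁻¹ * y⁻¹ ∈ D := by
  classical
  have hex : ∃ k, ∃ n : P, (n : G) ∈ S ∧ (n : G) ∉ D ∧ n ∈ Subgroup.upperCentralSeries P k := by
    obtain ⟨n, hn, hnD⟩ := SetLike.not_le_iff_exists.1 hSD
    obtain ⟨k, hk⟩ := hP.nilpotent'
    exact ⟨k, ⟨n, hSP hn⟩, hn, hnD, by rw [hk]; trivial⟩
  obtain ⟨n, hnS, hnD, hnk⟩ := Nat.find_spec hex
  have hmin := fun m hm => Nat.find_min hex (m := m) hm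
  generalize Nat.find hex = k at hnk hmin
  refine ⟨n, hnS, hnD, ?_⟩
  rintro x hx y hy ⟨e, rfl⟩ hxy
  cases k with
  | zero =>
    rw [Subgroup.upperCentralSeries_zero, mem_bot] at hnk
    subst hnk
    simp
  | succ k =>
    by_contra hcon
    have h1 : n ^ e ∈ Subgroup.upperCentralSeries P (k + 1) := zpow_mem hnk e
    rw [Subgroup.mem_upperCentralSeries_succ_iff] at h1
    have h2 := h1 ⟨x, hx⟩
    have h3 := inv_mem h2
    refine hmin k (Nat.lt_succ_self k) ⟨_, ?_, ?_, h3⟩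
    · simpa [commutatorElement_def, mul_assoc] using hxy
    · simpa [commutatorElement_def, mul_assoc] using hcon

theorem covBy_of_generated {P M L : Subgroup G} (hML : M ≤ L) (hPL : IsNormalIn L P)
    (hP : Group.IsNilpotent P) (hgen : ∀ l ∈ L, ∃ m ∈ M, ∃ x ∈ P, m * x = l)
    {D N : Subgroup G} (hD : IsNormalIn L D) (hN : IsNormalIn L N) (hNP : N ≤ P) (hNM : N ≤ M)
    (hDN : (⟨D, hD⟩ : NormalIn L) ⋖ ⟨N, hN⟩) :
    (⟨D, hD.mono hML ((show D ≤ N from hDN.le).trans hNM)⟩ : NormalIn M) ⋖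
      ⟨N, hN.mono hML hNM⟩ := by
  have hDleN : D ≤ N := hDN.le
  have hDneN : D ≠ N := fun h => hDN.ne (Subtype.ext h)
  let C : Subgroup G :=
    { carrier := {n | n ∈ N ∧ ∀ x ∈ P, x * n * x⁻¹ * n⁻¹ ∈ D}
      one_mem' := ⟨one_mem _, fun x _ => by simp⟩
      mul_mem' := by
        rintro n m ⟨hn, hn'⟩ ⟨hm, hm'⟩
        refine ⟨mul_mem hn hm, fun x hx => ?_⟩
        have : x * (n * m) * x⁻¹ * (n * m)⁻¹ =
          (x * n * x⁻¹ * n⁻¹) * (n * (x * m * x⁻¹ * m⁻¹) * n⁻¹) := by group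
        rw [this]
        exact mul_mem (hn' x hx) (hD.2 n (hN.1 hn) _ (hm' x hx))
      inv_mem' := by
        rintro n ⟨hn, hn'⟩
        refine ⟨inv_mem hn, fun x hx => ?_⟩
        have : x * n⁻¹ * x⁻¹ * n⁻¹⁻¹ =
          n⁻¹ * (x * n * x⁻¹ * n⁻¹)⁻¹ * n⁻¹⁻¹ := by group
        rw [this]
        exact hD.2 _ (inv_mem (hN.1 hn)) _ (inv_mem (hn' x hx)) }
  have hCL : IsNormalIn L C := by
    refine ⟨fun n hn => hN.1 hn.1, fun k hk n hn => ⟨hN.2 k hk n hn.1, fun x hx => ?_⟩⟩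
    have hx' : k⁻¹ * x * k ∈ P := by simpa using hPL.2 k⁻¹ (inv_mem hk) x hx
    have := hD.2 k hk _ (hn.2 _ hx')
    have e : k * (k⁻¹ * x * k * n * (k⁻¹ * x * k)⁻¹ * n⁻¹) * k⁻¹ =
      x * (k * n * k⁻¹) * x⁻¹ * (k * n * k⁻¹)⁻¹ := by group
    rwa [e] at this
  have hDC : D ≤ C := fun d hd => ⟨hDleN hd, fun x hx =>
    mul_mem (hD.2 x (hPL.1 hx) d hd) (inv_mem hd)⟩
  have hCD : C ≠ D := by
    intro h
    obtain ⟨n, hnN, hnD, hn⟩ := exists_commutator_descent hP hNP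
      (fun h => hDneN (le_antisymm hDleN h))
    refine hnD (h ▸ ⟨hnN, fun x hx => hn x hx n (hNP hnN) ⟨1, by simp⟩ ?_⟩)
    exact mul_mem (hN.2 x (hPL.1 hx) n hnN) (inv_mem hnN)
  have hCN : C = N := by
    rcases hDN.eq_or_eq (c := ⟨C, hCL⟩) hDC
      (show C ≤ N from fun n hn => hn.1) with h | h
    · exact absurd (congrArg Subtype.val h) hCD
    · exact congrArg Subtype.val h
  refine ⟨lt_of_le_of_ne hDleN fun h => hDneN (congrArg Subtype.val h), ?_⟩
  rintro ⟨E, hE⟩ hDE hEN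
  have hDE' : D ≤ E := hDE.le
  have hEN' : E ≤ N := hEN.le
  have hEL : IsNormalIn L E := by
    refine ⟨hEN'.trans hN.1, fun k hk n hn => ?_⟩
    obtain ⟨m, hm, x, hx, rfl⟩ := hgen k hk
    have hnC : n ∈ C := hCN ▸ hEN' hn
    have h1 : x * n * x⁻¹ ∈ E := by
      have := mul_mem (hDE' (hnC.2 x hx)) hn
      simpa using this
    have := hE.2 m hm _ h1
    have e : m * (x * n * x⁻¹) * m⁻¹ = m * x * n * (m * x)⁻¹ := by group
    rwa [e] at this
  rcases hDN.eq_or_eq (c := ⟨E, hEL⟩) hDE' hEN' with h | h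
  · have h' : E = D := congrArg Subtype.val h
    exact hDE.ne' (Subtype.ext h')
  · have h' : E = N := congrArg Subtype.val h
    exact hEN.ne (Subtype.ext h')

variable [Finite G]

theorem normalHeight_eq_of_generated {P M L : Subgroup G} (hML : M ≤ L) (hPL : IsNormalIn L P)
    (hP : Group.IsNilpotent P) (hgen : ∀ l ∈ L, ∃ m ∈ M, ∃ x ∈ P, m * x = l) :
    ∀ (N : NormalIn L), N.1 ≤ P → ∀ (hNM : N.1 ≤ M),
      normalHeight L N.1 N.2 = normalHeight M N.1 (N.2.mono hML hNM) := by
  intro N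
  induction N using WellFoundedLT.induction with
  | ind N ih =>
    intro hNP hNM
    by_cases hmin : ∃ D : NormalIn L, D < N
    · obtain ⟨D₀, hD₀⟩ := hmin
      obtain ⟨D, -, hD⟩ := exists_le_covBy_of_lt hD₀
      have hDN : D.1 ≤ N.1 := hD.le
      have h1 := ih D hD.lt (hDN.trans hNP) (hDN.trans hNM)
      have h2 := covBy_of_generated hML hPL hP hgen D.2 N.2 hNP hNM hD
      unfold normalHeight at h1 ⊢
      rw [height_eq_of_covBy h2, ← h1]
      exact height_eq_of_covBy hD
    · have hbot : N.1 = ⊥ := by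
        by_contra hne
        exact hmin ⟨⟨⊥, bot_le, fun k _ n hn => by
          rw [mem_bot] at hn; simp [hn]⟩, bot_lt_iff_ne_bot.2 hne⟩
      have h1 : normalHeight L N.1 N.2 = 0 := by
        unfold normalHeight
        rw [Order.height_eq_zero]
        intro a ha
        change N.1 ≤ a.1
        rw [hbot]; exact bot_le
      have h2 : normalHeight M N.1 (N.2.mono hML hNM) = 0 := by
        unfold normalHeight
        rw [Order.height_eq_zero]
        intro a ha
        change N.1 ≤ a.1
        rw [hbot]; exact bot_le
      rw [h1, h2]

variable {X : Subgroup G} [hXn : X.Normal]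

theorem normalHeight_of_covBy {p : ℕ} (hp : p.Prime) (hX : IsPGroup p X) {M L : Subgroup G}
    (hML : M ⋖ L) (hXM : ¬ L ⊓ X ≤ M) :
    normalHeight L (L ⊓ X) (isNormalIn_inf_of_normal L X) =
      normalHeight M (M ⊓ X) (isNormalIn_inf_of_normal M X) + 1 := by
  have := Fact.mk hp
  have hPL := isNormalIn_inf_of_normal L X
  have hP : Group.IsNilpotent ↥(L ⊓ X) := (hX.to_le inf_le_right).isNilpotent
  have hjoin : ∀ E : Subgroup G, E ≤ L → ¬ E ≤ M → M ⊔ E = L := by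
    intro E hEL hEM
    rcases hML.eq_or_eq (c := M ⊔ E) le_sup_left (sup_le hML.le hEL) with h | h
    · exact absurd (h ▸ le_sup_right) hEM
    · exact h
  have hgen : ∀ E : Subgroup G, IsNormalIn L E → ¬ E ≤ M →
      ∀ l ∈ L, ∃ m ∈ M, ∃ x ∈ E, m * x = l := by
    intro E hE hEM l hl
    rw [← hjoin E hE.1 hEM] at hl
    exact exists_mul_of_mem_sup (fun x hx => hE.2 x (hML.le hx)) hl
  have hDL : IsNormalIn L (M ⊓ X) := by
    refine ⟨inf_le_left.trans hML.le, fun k hk n hn => ?_⟩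
    obtain ⟨x, hxP, hxM, hx⟩ := exists_commutator_descent hP le_rfl hXM
    have key : ∀ y ∈ L ⊓ X, (∃ e : ℤ, y = x ^ e) → ∀ d ∈ M ⊓ X, y * d * y⁻¹ ∈ M ⊓ X := by
      intro y hy hyx d hd
      have hdP : d ∈ L ⊓ X := ⟨hML.le hd.1, hd.2⟩
      have h1 := hx d hdP y hy hyx
        ((L ⊓ X).mul_mem ((L ⊓ X).mul_mem ((L ⊓ X).mul_mem hdP hy)
          ((L ⊓ X).inv_mem hdP)) ((L ⊓ X).inv_mem hy))
      refine ⟨?_, hXn.conj_mem d hd.2 y⟩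
      have h2 := mul_mem (inv_mem h1) hd.1
      have e : (d * y * d⁻¹ * y⁻¹)⁻¹ * d = y * d * y⁻¹ := by group
      rwa [e] at h2
    have hxn : x ∈ normalizer ((M ⊓ X : Subgroup G) : Set G) := by
      rw [mem_normalizer_iff]
      intro d
      refine ⟨key x hxP ⟨1, by simp⟩ d, fun hd => ?_⟩
      have := key x⁻¹ (inv_mem hxP) ⟨-1, by simp⟩ _ hd
      simpa [mul_assoc] using this
    have hMn : M ≤ normalizer ((M ⊓ X : Subgroup G) : Set G) := by
      have := isNormalIn_inf_of_normal M X
      intro m hm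
      rw [mem_normalizer_iff]
      intro d
      refine ⟨this.2 m hm d, fun hd => ?_⟩
      have := this.2 m⁻¹ (inv_mem hm) _ hd
      simpa [mul_assoc] using this
    have hLn : L ≤ normalizer ((M ⊓ X : Subgroup G) : Set G) := by
      rw [← hjoin (zpowers x) (zpowers_le.2 hxP.1) (fun h => hxM (h (mem_zpowers x)))]
      exact sup_le hMn (zpowers_le.2 hxn)
    exact (mem_normalizer_iff.1 (hLn hk) n).1 hn
  have hcov : (⟨M ⊓ X, hDL⟩ : NormalIn L) ⋖ ⟨L ⊓ X, hPL⟩ := by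
    refine ⟨lt_of_le_of_ne (inf_le_inf_right X hML.le) fun h => hXM ?_, ?_⟩
    · have h' : M ⊓ X = L ⊓ X := congrArg Subtype.val h
      rw [← h']; exact inf_le_left
    · rintro ⟨E, hE⟩ hDE hEP
      have hDE' : M ⊓ X ≤ E := hDE.le
      have hEP' : E ≤ L ⊓ X := hEP.le
      by_cases hEM : E ≤ M
      · exact hDE.ne (Subtype.ext (le_antisymm hDE' (le_inf hEM (hEP'.trans inf_le_right))))
      · refine hEP.not_ge fun q hq => ?_
        obtain ⟨m, hm, x, hx, rfl⟩ := hgen E hE hEM q hq.1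
        have hmX : m ∈ X := by
          have := X.mul_mem hq.2 (X.inv_mem (hEP' hx).2)
          simpa using this
        exact mul_mem (hDE' ⟨hm, hmX⟩) hx
  have h1 := normalHeight_eq_of_generated hML.le hPL hP (hgen _ hPL hXM) ⟨M ⊓ X, hDL⟩
    (inf_le_inf_right X hML.le) inf_le_left
  unfold normalHeight at h1 ⊢
  rw [height_eq_of_covBy hcov, h1]

theorem normalHeight_add_one_le {p : ℕ} (hp : p.Prime) (hX : IsPGroup p X) {K : Subgroup G} :
    ∀ L : Subgroup G, K < L → L ≤ K ⊔ X →
    normalHeight K (K ⊓ X) (isNormalIn_inf_of_normal K X) + 1 ≤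
      normalHeight L (L ⊓ X) (isNormalIn_inf_of_normal L X) := by
  intro L
  induction L using WellFoundedLT.induction with
  | ind L ih =>
    intro hKL hLX
    obtain ⟨M, hKM, hML⟩ := exists_le_covBy_of_lt hKL
    have hXM : ¬ L ⊓ X ≤ M := by
      intro h
      refine hML.lt.not_ge fun l hl => ?_
      obtain ⟨k, hk, x, hx, rfl⟩ := exists_mul_of_mem_sup
        (fun k _ x hx => hXn.conj_mem x hx k) (hLX hl)
      have hxL : x ∈ L := by
        have := mul_mem (inv_mem (hKL.le hk)) hl
        simpa using this
      exact mul_mem (hKM hk) (h ⟨hxL, hx⟩)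
    rw [normalHeight_of_covBy hp hX hML hXM]
    rcases hKM.eq_or_lt with h | h
    · subst h; exact le_rfl
    · exact (ih M hML.lt h (hML.le.trans hLX)).trans le_self_add

end NormalHeight

section PGroupCase

variable {G Γ : Type*} [Group G] [Group Γ]

theorem card_range_of_injective (i : Γ →* G) (hi : Function.Injective i) :
    Nat.card i.range = Nat.card Γ :=
  (Nat.card_congr (MonoidHom.ofInjective hi).toEquiv).symm

theorem comap_map_of_injective {i : Γ →* G} (hi : Function.Injective i) (N : Subgroup Γ) :
    (N.map i).comap i = N :=
  Subgroup.comap_map_eq_self_of_injective hi N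

theorem range_inf_eq_map_comap (i : Γ →* G) (X : Subgroup G) :
    i.range ⊓ X = (X.comap i).map i := (map_comap_eq i X).symm

theorem isNormalIn_map_comap {i : Γ →* G} (j : Γ →* G) {N : Subgroup G}
    (hN : IsNormalIn i.range N) : IsNormalIn j.range ((N.comap i).map j) := by
  refine ⟨map_le_range _ _, ?_⟩
  rintro _ ⟨k, rfl⟩ _ ⟨n, hn, rfl⟩
  refine ⟨k * n * k⁻¹, ?_, by simp⟩
  have := hN.2 (i k) ⟨k, rfl⟩ _ hn
  simpa using this

theorem normalHeight_le_of_injective {i j : Γ →* G} (hi : Function.Injective i)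
    (hj : Function.Injective j) {X : Subgroup G} [X.Normal]
    (hX : ∀ γ, i γ ∈ X ↔ j γ ∈ X) :
    normalHeight i.range (i.range ⊓ X) (isNormalIn_inf_of_normal _ X) ≤
      normalHeight j.range (j.range ⊓ X) (isNormalIn_inf_of_normal _ X) := by
  have hmono : StrictMono fun N : NormalIn i.range =>
      (⟨_, isNormalIn_map_comap j N.2⟩ : NormalIn j.range) := by
    intro N M h
    refine lt_of_le_of_ne (map_mono (comap_mono h.le)) fun he => h.ne ?_
    have h1 : (N.1.comap i).map j = (M.1.comap i).map j := Subtype.ext_iff.1 he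
    have h2 := map_injective hj h1
    have h3 := congrArg (Subgroup.map i) h2
    rw [map_comap_eq, map_comap_eq, inf_eq_right.2 N.2.1, inf_eq_right.2 M.2.1] at h3
    exact Subtype.ext h3
  refine (Order.height_le_height_apply_of_strictMono _ hmono _).trans (le_of_eq ?_)
  unfold normalHeight
  congr 1
  apply Subtype.ext
  change ((i.range ⊓ X).comap i).map j = j.range ⊓ X
  rw [range_inf_eq_map_comap i, comap_map_of_injective hi, range_inf_eq_map_comap j]
  congr 1
  ext γ
  exact hX γ

theorem card_range_inf_eq {i j : Γ →* G} (hi : Function.Injective i) (hj : Function.Injective j)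
    {X : Subgroup G} (hX : ∀ γ, i γ ∈ X ↔ j γ ∈ X) :
    Nat.card ↥(i.range ⊓ X) = Nat.card ↥(j.range ⊓ X) := by
  rw [range_inf_eq_map_comap, range_inf_eq_map_comap, card_map_of_injective' i hi,
    card_map_of_injective' j hj]
  congr 1
  have : X.comap i = X.comap j := by ext γ; exact hX γ
  rw [this]

variable [Finite G]

theorem index_range_eq {i j : Γ →* G} (hi : Function.Injective i) (hj : Function.Injective j) :
    j.range.index = i.range.index := by
  have h1 := card_mul_index i.range
  have h2 := card_mul_index j.range
  rw [card_range_of_injective i hi] at h1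
  rw [card_range_of_injective j hj] at h2
  have : 0 < Nat.card Γ := by
    have := Finite.of_injective i hi
    exact Nat.card_pos
  exact Nat.eq_of_mul_eq_mul_left this (h2.trans h1.symm)

theorem range_ne_top {i j : Γ →* G} (hi : Function.Injective i) (hj : Function.Injective j)
    (hH : i.range ≠ ⊤) : j.range ≠ ⊤ := by
  intro h
  have := index_range_eq hi hj
  rw [h, index_top] at this
  exact hH (index_eq_one.1 this.symm)

theorem range_sup_eq_top {i j : Γ →* G} (hi : Function.Injective i) (hj : Function.Injective j)
    {X : Subgroup G} [X.Normal] (hX : ∀ γ, i γ ∈ X ↔ j γ ∈ X) (h : i.range ⊔ X = ⊤) :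
    j.range ⊔ X = ⊤ := by
  have h1 := card_sup_mul_card_inf i.range X
  have h2 := card_sup_mul_card_inf j.range X
  rw [h, card_range_of_injective i hi, card_range_inf_eq hi hj hX] at h1
  rw [card_range_of_injective j hj, ← h1] at h2
  have := Nat.eq_of_mul_eq_mul_right Nat.card_pos h2
  rw [← card_eq_iff_eq_top, this]
  exact Nat.card_congr topEquiv.toEquiv

theorem isCoatom_range_of_isPGroup {i j : Γ →* G} (hi : Function.Injective i)
    (hj : Function.Injective j) {X : Subgroup G} [X.Normal] {p : ℕ} (hp : p.Prime)
    (hXp : IsPGroup p X) (hH : IsCoatom i.range) (hXH : ¬ X ≤ i.range)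
    (hX : ∀ γ, i γ ∈ X ↔ j γ ∈ X) : IsCoatom j.range := by
  have hsup : i.range ⊔ X = ⊤ := by
    rcases hH.le_iff.1 (le_sup_left : i.range ≤ i.range ⊔ X) with h | h
    · exact h
    · exact absurd (h ▸ le_sup_right) hXH
  have h1 := normalHeight_of_covBy hp hXp (covBy_top_iff.2 hH) (by rwa [top_inf_eq])
  have hne : normalHeight i.range (i.range ⊓ X) (isNormalIn_inf_of_normal _ X) ≠ ⊤ :=
    height_ne_top_of_finite _
  have h2 := le_antisymm (normalHeight_le_of_injective hi hj hX)
    (normalHeight_le_of_injective hj hi fun γ => (hX γ).symm)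
  refine ⟨range_ne_top hi hj hH.1, fun L hL => ?_⟩
  by_contra hLt
  have h3 := normalHeight_add_one_le (X := X) hp hXp L hL
    (by rw [range_sup_eq_top hi hj hX hsup]; exact le_top)
  have h4 := normalHeight_add_one_le (X := X) hp hXp ⊤ (lt_top_iff_ne_top.2 hLt)
    (by rw [← range_sup_eq_top hi hj hX hsup]; exact sup_le_sup_right hL.le X)
  rw [h1, h2] at h4
  rw [h2] at hne
  have h5 := (add_le_add_left h3 1).trans h4
  obtain ⟨n, hn⟩ := ENat.ne_top_iff_exists.1 hne
  rw [← hn] at h5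
  norm_cast at h5
  omega

end PGroupCase

section MaximalPairs

/-- Two embeddings of `Γ` in the solvable group `G`, meeting the normal subgroup `X` in the same
subgroup of `Γ`, such that the first image is maximal of `p`-power index and does not
contain `X`. -/
structure IsMaximalPair (p : ℕ) {G Γ : Type} [Group G] [Group Γ] (i j : Γ →* G)
    (X : Subgroup G) : Prop where
  isSolvable : Group.IsSolvable G
  prime : p.Prime
  injective_left : Function.Injective i
  injective_right : Function.Injective j
  normal : X.Normal
  isCoatom : IsCoatom i.range
  index_eq : ∃ a, i.range.index = p ^ a
  not_le : ¬ X ≤ i.range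
  mem_iff : ∀ γ, i γ ∈ X ↔ j γ ∈ X
  good : ∀ r, r.Prime → r ∣ Nat.card X → ¬ (p = 2 ∧ r = 3) ∧ ¬ (p = 3 ∧ r = 2)

/-- Maximal pairs of total order less than `n` have maximal second image. -/
def MaximalPairsBelow (p n : ℕ) : Prop :=
  ∀ (G Γ : Type) [Group G] [Group Γ] [Finite G] (i j : Γ →* G) (X : Subgroup G),
    Nat.card G + Nat.card X < n → IsMaximalPair p i j X → IsCoatom j.range

variable {p : ℕ} {G Γ : Type} [Group G] [Group Γ] {i j : Γ →* G} {X : Subgroup G}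

theorem isCoatom_map_of_surjective {Q : Type*} [Group Q] {π : G →* Q}
    (hπ : Function.Surjective π) {H : Subgroup G} (hker : π.ker ≤ H) (hH : IsCoatom H) :
    IsCoatom (H.map π) := by
  have hc : (H.map π).comap π = H := by rw [comap_map_eq, sup_eq_left.2 hker]
  refine ⟨fun h => hH.1 ?_, fun L hL => ?_⟩
  · rw [← hc, h, comap_top]
  · have h1 : H < L.comap π := by
      rw [← hc]
      exact (comap_lt_comap_of_surjective hπ).2 hL
    have h2 := hH.2 _ h1
    rw [← map_comap_eq_self_of_surjective hπ L, h2, map_top_of_surjective π hπ]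

theorem isCoatom_of_isCoatom_map {Q : Type*} [Group Q] {π : G →* Q}
    (hπ : Function.Surjective π) {H : Subgroup G} (hker : π.ker ≤ H) (hH : IsCoatom (H.map π)) :
    IsCoatom H := by
  have h := isCoatom_comap_of_surjective hπ hH
  rwa [comap_map_eq, sup_eq_left.2 hker] at h

variable [Finite G]

theorem le_range_of_mem_iff (hi : Function.Injective i) (hj : Function.Injective j)
    {W : Subgroup G} [W.Normal] (hW : ∀ γ, i γ ∈ W ↔ j γ ∈ W) (h : W ≤ i.range) :
    W ≤ j.range := by
  have h1 := card_range_inf_eq hi hj hW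
  rw [inf_eq_right.2 h] at h1
  have h2 : j.range ⊓ W = W := eq_of_le_of_card_ge inf_le_right h1.le
  exact inf_eq_right.1 h2

namespace IsMaximalPair

theorem isCoatom_of_normal_le (h : IsMaximalPair p i j X)
    (hIH : MaximalPairsBelow p (Nat.card G + Nat.card X)) {W : Subgroup G} [hW : W.Normal]
    (hne : W ≠ ⊥) (hWi : W ≤ i.range) (hWm : ∀ γ, i γ ∈ W ↔ j γ ∈ W) : IsCoatom j.range := by
  have hWj : W ≤ j.range := le_range_of_mem_iff h.injective_left h.injective_right hWm hWi
  have hsol := h.isSolvable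
  have hXn := h.normal
  let π := QuotientGroup.mk' W
  have hπ : Function.Surjective π := QuotientGroup.mk'_surjective W
  have hker : π.ker = W := QuotientGroup.ker_mk' W
  let i' : Γ ⧸ W.comap i →* G ⧸ W := QuotientGroup.map _ W i le_rfl
  let j' : Γ ⧸ W.comap i →* G ⧸ W := QuotientGroup.map _ W j fun γ hγ => (hWm γ).1 hγ
  have hi'r : i'.range = i.range.map π := by
    ext x
    constructor
    · rintro ⟨y, rfl⟩
      induction y using QuotientGroup.induction_on with
      | H y => exact ⟨i y, ⟨y, rfl⟩, rfl⟩
    · rintro ⟨_, ⟨y, rfl⟩, rfl⟩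
      exact ⟨(y : Γ ⧸ W.comap i), rfl⟩
  have hj'r : j'.range = j.range.map π := by
    ext x
    constructor
    · rintro ⟨y, rfl⟩
      induction y using QuotientGroup.induction_on with
      | H y => exact ⟨j y, ⟨y, rfl⟩, rfl⟩
    · rintro ⟨_, ⟨y, rfl⟩, rfl⟩
      exact ⟨(y : Γ ⧸ W.comap i), rfl⟩
  have key : IsMaximalPair p i' j' (X.map π) :=
    { isSolvable := Group.isSolvable_of_surjective hπ
      prime := h.prime
      injective_left := by
        rw [injective_iff_map_eq_one]
        intro y hy
        induction y using QuotientGroup.induction_on with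
        | H y =>
          rw [QuotientGroup.eq_one_iff]
          exact (QuotientGroup.eq_one_iff (i y)).1 hy
      injective_right := by
        rw [injective_iff_map_eq_one]
        intro y hy
        induction y using QuotientGroup.induction_on with
        | H y =>
          rw [QuotientGroup.eq_one_iff]
          exact (hWm y).2 ((QuotientGroup.eq_one_iff (j y)).1 hy)
      normal := hXn.map π hπ
      isCoatom := by
        rw [hi'r]
        exact isCoatom_map_of_surjective hπ (hker.trans_le hWi) h.isCoatom
      index_eq := by
        rw [hi'r, index_map_eq _ hπ (hker.trans_le hWi)]
        exact h.index_eq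
      not_le := by
        rw [hi'r, Subgroup.map_le_map_iff, hker, sup_eq_left.2 hWi]
        exact h.not_le
      mem_iff := by
        have aux : ∀ g : G, π g ∈ X.map π ↔ g ∈ X ⊔ W := by
          intro g
          rw [← mem_comap, comap_map_eq, hker]
        intro y
        induction y using QuotientGroup.induction_on with
        | H y =>
          refine (aux (i y)).trans (Iff.trans ?_ (aux (j y)).symm)
          constructor
          · intro hy
            obtain ⟨x, hx, w, hw, hxw⟩ := exists_mul_of_mem_sup
              (fun x _ w hw => hW.conj_mem w hw x) hy
            obtain ⟨δ, rfl⟩ := hWi hw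
            have h1 : i (y * δ⁻¹) ∈ X := by
              rw [map_mul, ← hxw, map_inv]; simpa using hx
            have h2 := (h.mem_iff _).1 h1
            have : j y = j (y * δ⁻¹) * j δ := by rw [← map_mul]; simp
            rw [this]
            exact mul_mem (mem_sup_left h2) (mem_sup_right ((hWm δ).1 hw))
          · intro hy
            obtain ⟨x, hx, w, hw, hxw⟩ := exists_mul_of_mem_sup
              (fun x _ w hw => hW.conj_mem w hw x) hy
            obtain ⟨δ, rfl⟩ := hWj hw
            have h1 : j (y * δ⁻¹) ∈ X := by
              rw [map_mul, ← hxw, map_inv]; simpa using hx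
            have h2 := (h.mem_iff _).2 h1
            have : i y = i (y * δ⁻¹) * i δ := by rw [← map_mul]; simp
            rw [this]
            exact mul_mem (mem_sup_left h2) (mem_sup_right ((hWm δ).2 hw))
      good := fun r hr hrd => h.good r hr (hrd.trans (card_map_dvd X π)) }
  have hcard : Nat.card (G ⧸ W) + Nat.card (X.map π) < Nat.card G + Nat.card X := by
    have h1 := Nat.le_of_dvd Nat.card_pos (card_map_dvd X π)
    have h2 := card_eq_card_quotient_mul_card_subgroup W
    have h3 : 1 < Nat.card W := (one_lt_card_iff_ne_bot W).2 hne
    have h4 : 0 < Nat.card (G ⧸ W) := Nat.card_pos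
    have h5 : Nat.card (G ⧸ W) < Nat.card G := by rw [h2]; nlinarith
    omega
  have := hIH _ _ i' j' (X.map π) hcard key
  rw [hj'r] at this
  exact isCoatom_of_isCoatom_map hπ (hker.trans_le hWj) this

theorem mem_map_pPrimeCore_iff (h : IsMaximalPair p i j X) {s : ℕ} (hs : s.Prime) (hsp : s ≠ p)
    (γ : Γ) : i γ ∈ (pPrimeCore s X).map X.subtype ↔ j γ ∈ (pPrimeCore s X).map X.subtype := by
  have hsol := h.isSolvable
  have hXn := h.normal
  have hfin : Finite Γ := Finite.of_injective i h.injective_left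
  have hcop : ∀ K : Subgroup G, (∃ a, K.index = p ^ a) → (K.subgroupOf X).index.Coprime s := by
    rintro K ⟨a, ha⟩
    have h1 : K.relIndex X ∣ K.index := by
      rw [← relIndex_sup_right_of_normal]
      exact relIndex_dvd_index_of_le le_sup_left
    rw [ha] at h1
    refine Nat.Coprime.coprime_dvd_left h1 (Nat.Coprime.pow_left a ?_)
    exact (Nat.coprime_primes h.prime hs).2 hsp.symm
  let iX : X.comap i →* X := (i.comp (X.comap i).subtype).codRestrict X fun γ => γ.2
  let jX : X.comap i →* X :=
    (j.comp (X.comap i).subtype).codRestrict X fun γ => (h.mem_iff _).1 γ.2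
  have hiX : Function.Injective iX := by
    intro a b hab
    exact Subtype.ext (h.injective_left (congrArg Subtype.val hab))
  have hjX : Function.Injective jX := by
    intro a b hab
    exact Subtype.ext (h.injective_right (congrArg Subtype.val hab))
  have hir : iX.range = i.range.subgroupOf X := by
    ext x
    constructor
    · rintro ⟨y, rfl⟩
      exact ⟨y, rfl⟩
    · rintro ⟨y, hy⟩
      exact ⟨⟨y, by rw [mem_comap, hy]; exact x.2⟩, Subtype.ext hy⟩
  have hjr : jX.range = j.range.subgroupOf X := by
    ext x
    constructor
    · rintro ⟨y, rfl⟩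
      exact ⟨y, rfl⟩
    · rintro ⟨y, hy⟩
      exact ⟨⟨y, by rw [mem_comap, h.mem_iff, hy]; exact x.2⟩, Subtype.ext hy⟩
  have hXs : Group.IsSolvable X := inferInstance
  have h1 := map_pPrimeCore_eq_inf hXs hs iX hiX (by rw [hir]; exact hcop _ h.index_eq)
  have h2 := map_pPrimeCore_eq_inf hXs hs jX hjX (by
    rw [hjr]
    refine hcop _ ?_
    rw [index_range_eq h.injective_left h.injective_right]
    exact h.index_eq)
  rw [h1] at h2
  constructor
  · rintro ⟨x, hx, hxi⟩
    have hγ : γ ∈ X.comap i := by rw [mem_comap, ← hxi]; exact x.2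
    have h3 : (⟨γ, hγ⟩ : X.comap i) ∈ (pPrimeCore s X).comap iX := by
      rw [mem_comap]
      have : iX ⟨γ, hγ⟩ = x := Subtype.ext hxi.symm
      rw [this]; exact hx
    rw [h2] at h3
    exact ⟨_, h3, rfl⟩
  · rintro ⟨x, hx, hxj⟩
    have hγ : γ ∈ X.comap i := by rw [mem_comap, h.mem_iff, ← hxj]; exact x.2
    have h3 : (⟨γ, hγ⟩ : X.comap i) ∈ (pPrimeCore s X).comap jX := by
      rw [mem_comap]
      have : jX ⟨γ, hγ⟩ = x := Subtype.ext hxj.symm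
      rw [this]; exact hx
    rw [← h2] at h3
    exact ⟨_, h3, rfl⟩

theorem pPrimeCore_eq_bot (h : IsMaximalPair p i j X)
    (hIH : MaximalPairsBelow p (Nat.card G + Nat.card X)) (hj : ¬ IsCoatom j.range)
    {s : ℕ} (hs : s.Prime) (hsp : s ≠ p) (hsX : s ∣ Nat.card X) : pPrimeCore s X = ⊥ := by
  by_contra hne
  have hXn := h.normal
  have hch := pPrimeCore_characteristic s (G := X)
  have hn : ((pPrimeCore s X).map X.subtype).Normal := inferInstance
  have hmem := h.mem_map_pPrimeCore_iff hs hsp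
  by_cases hle : (pPrimeCore s X).map X.subtype ≤ i.range
  · refine hj (h.isCoatom_of_normal_le hIH ?_ hle hmem)
    rwa [Ne, map_eq_bot_iff_of_injective _ X.subtype_injective]
  · refine hj (hIH G Γ i j _ ?_
      { h with normal := hn, not_le := hle, mem_iff := hmem, good := ?_ })
    · rw [card_map_of_injective' _ X.subtype_injective]
      have h1 := Nat.le_of_dvd Nat.card_pos (card_subgroup_dvd_card (pPrimeCore s X))
      have h2 : Nat.card (pPrimeCore s X) ≠ Nat.card X := by
        intro h2
        have h3 := pPrimeCore_coprime s (G := X)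
        rw [h2] at h3
        exact hs.one_lt.ne' (Nat.eq_one_of_dvd_coprimes h3 hsX dvd_rfl)
      omega
    · intro r hr hrd
      rw [card_map_of_injective' _ X.subtype_injective] at hrd
      exact h.good r hr (hrd.trans (card_subgroup_dvd_card _))

end IsMaximalPair

end MaximalPairs

section Thompson

variable {G : Type*} [Group G]

/-- `E` is an elementary abelian `r`-group. -/
def IsElementaryAbelian (r : ℕ) (E : Subgroup G) : Prop :=
  (∀ e ∈ E, ∀ f ∈ E, e * f = f * e) ∧ ∀ e ∈ E, e ^ r = 1

/-- `E` is an elementary abelian `r`-subgroup of `Q` of largest order. -/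
def IsLargestElementaryAbelian (r : ℕ) (Q E : Subgroup G) : Prop :=
  E ≤ Q ∧ IsElementaryAbelian r E ∧
    ∀ F ≤ Q, IsElementaryAbelian r F → Nat.card F ≤ Nat.card E

/-- The Thompson subgroup of `Q`, generated by the elementary abelian `r`-subgroups of largest
order. -/
def thompson (r : ℕ) (Q : Subgroup G) : Subgroup G :=
  sSup {E | IsLargestElementaryAbelian r Q E}

/-- The elements of order dividing `r` in the center of `Q`. -/
def zOmega (r : ℕ) (Q : Subgroup G) : Subgroup G where
  carrier := {z | z ∈ Q ∧ (∀ q ∈ Q, z * q = q * z) ∧ z ^ r = 1}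
  one_mem' := ⟨one_mem _, fun q _ => by simp, one_pow r⟩
  mul_mem' := by
    rintro a b ⟨ha, ha', har⟩ ⟨hb, hb', hbr⟩
    refine ⟨mul_mem ha hb, fun q hq => ?_, ?_⟩
    · rw [mul_assoc, hb' q hq, ← mul_assoc, ha' q hq, mul_assoc]
    · rw [(show Commute a b from ha' b hb).mul_pow, har, hbr, one_mul]
  inv_mem' := by
    rintro a ⟨ha, ha', har⟩
    exact ⟨inv_mem ha, fun q hq => (show Commute a q from ha' q hq).inv_left, by
      rw [inv_pow, har, inv_one]⟩

theorem zOmega_le (r : ℕ) (Q : Subgroup G) : zOmega r Q ≤ Q := fun _ h => h.1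

theorem thompson_le (r : ℕ) (Q : Subgroup G) : thompson r Q ≤ Q := sSup_le fun _ h => h.1

theorem IsLargestElementaryAbelian.le_thompson {r : ℕ} {Q E : Subgroup G}
    (h : IsLargestElementaryAbelian r Q E) : E ≤ thompson r Q := le_sSup h

theorem isElementaryAbelian_zOmega (r : ℕ) (Q : Subgroup G) :
    IsElementaryAbelian r (zOmega r Q) :=
  ⟨fun _ he f hf => he.2.1 f hf.1, fun _ he => he.2.2⟩

section Map

variable {Γ : Type*} [Group Γ] {f : Γ →* G}

theorem map_zOmega (hf : Function.Injective f) (r : ℕ) (Q : Subgroup Γ) :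
    (zOmega r Q).map f = zOmega r (Q.map f) := by
  ext z
  constructor
  · rintro ⟨z, ⟨hz, hz', hzr⟩, rfl⟩
    refine ⟨mem_map_of_mem f hz, ?_, by rw [← map_pow, hzr, map_one]⟩
    rintro _ ⟨q, hq, rfl⟩
    rw [← map_mul, hz' q hq, map_mul]
  · rintro ⟨⟨z, hz, rfl⟩, hz', hzr⟩
    refine ⟨z, ⟨hz, fun q hq => hf ?_, hf ?_⟩, rfl⟩
    · rw [map_mul, map_mul, hz' _ (mem_map_of_mem f hq)]
    · rw [map_pow, hzr, map_one]

theorem isElementaryAbelian_map_iff (hf : Function.Injective f) {r : ℕ} {E : Subgroup Γ} :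
    IsElementaryAbelian r (E.map f) ↔ IsElementaryAbelian r E := by
  constructor
  · rintro ⟨h1, h2⟩
    refine ⟨fun a ha b hb => hf ?_, fun a ha => hf ?_⟩
    · rw [map_mul, map_mul, h1 _ (mem_map_of_mem f ha) _ (mem_map_of_mem f hb)]
    · rw [map_pow, map_one, h2 _ (mem_map_of_mem f ha)]
  · rintro ⟨h1, h2⟩
    refine ⟨?_, ?_⟩
    · rintro _ ⟨a, ha, rfl⟩ _ ⟨b, hb, rfl⟩
      rw [← map_mul, h1 a ha b hb, map_mul]
    · rintro _ ⟨a, ha, rfl⟩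
      rw [← map_pow, h2 a ha, map_one]

theorem exists_map_eq_of_le_map {Q : Subgroup Γ} {F : Subgroup G} (hF : F ≤ Q.map f)
    (hf : Function.Injective f) : ∃ F' ≤ Q, F'.map f = F := by
  refine ⟨F.comap f, ?_, ?_⟩
  · rw [← comap_map_of_injective hf Q]
    exact comap_mono hF
  · rw [map_comap_eq, inf_eq_right]
    exact hF.trans (map_le_range f Q)

theorem isLargestElementaryAbelian_map_iff (hf : Function.Injective f) {r : ℕ}
    {Q E : Subgroup Γ} :
    IsLargestElementaryAbelian r (Q.map f) (E.map f) ↔ IsLargestElementaryAbelian r Q E := by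
  unfold IsLargestElementaryAbelian
  rw [isElementaryAbelian_map_iff hf, map_le_map_iff_of_injective hf, card_map_of_injective' f hf]
  refine and_congr_right fun _ => and_congr_right fun _ =>
    ⟨fun h F hF hFe => ?_, fun h F hF hFe => ?_⟩
  · rw [← card_map_of_injective' f hf F]
    exact h _ (map_mono hF) ((isElementaryAbelian_map_iff hf).2 hFe)
  · obtain ⟨F, hF', rfl⟩ := exists_map_eq_of_le_map hF hf
    rw [card_map_of_injective' f hf F]
    exact h F hF' ((isElementaryAbelian_map_iff hf).1 hFe)

theorem map_thompson (hf : Function.Injective f) (r : ℕ) (Q : Subgroup Γ) :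
    (thompson r Q).map f = thompson r (Q.map f) := by
  apply le_antisymm
  · rw [map_le_iff_le_comap]
    refine sSup_le fun E hE => ?_
    rw [← map_le_iff_le_comap]
    exact le_sSup ((isLargestElementaryAbelian_map_iff hf).2 hE)
  · refine sSup_le fun E hE => ?_
    obtain ⟨E, -, rfl⟩ := exists_map_eq_of_le_map hE.1 hf
    exact map_mono (le_sSup ((isLargestElementaryAbelian_map_iff hf).1 hE))

end Map

theorem le_sylow_of_normal {r : ℕ} {N : Subgroup G} [N.Normal] (hN : IsPGroup r N)
    (S : Sylow r G) : N ≤ S := by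
  have h := S.is_maximal' (S.2.to_sup_of_normal_right hN) le_sup_left
  rw [← h]
  exact le_sup_right

variable [Finite G]

theorem exists_isLargestElementaryAbelian (r : ℕ) (Q : Subgroup G) :
    ∃ E, IsLargestElementaryAbelian r Q E := by
  have hne : {E : Subgroup G | E ≤ Q ∧ IsElementaryAbelian r E}.Nonempty :=
    ⟨_, zOmega_le r Q, isElementaryAbelian_zOmega r Q⟩
  obtain ⟨E, hE, hmax⟩ := Set.exists_max_image _ (fun E : Subgroup G => Nat.card E)
    (Set.toFinite _) hne
  exact ⟨E, hE.1, hE.2, fun F hF hFe => hmax F ⟨hF, hFe⟩⟩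

theorem thompson_eq_of_le {r : ℕ} {Q R : Subgroup G} (hRQ : R ≤ Q) (hR : thompson r Q ≤ R) :
    thompson r R = thompson r Q := by
  unfold thompson
  congr 1
  ext E
  constructor
  · rintro ⟨h1, h2, h3⟩
    obtain ⟨F, hF⟩ := exists_isLargestElementaryAbelian r Q
    exact ⟨h1.trans hRQ, h2, fun F' hF' hFe =>
      (hF.2.2 F' hF' hFe).trans (h3 F (hF.le_thompson.trans hR) hF.2.1)⟩
  · intro h
    exact ⟨h.le_thompson.trans hR, h.2.1,
      fun F hF hFe => h.2.2 F (hF.trans hRQ) hFe⟩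

theorem thompson_ne_bot {r : ℕ} {Q : Subgroup G} (h : zOmega r Q ≠ ⊥) : thompson r Q ≠ ⊥ := by
  obtain ⟨F, hF⟩ := exists_isLargestElementaryAbelian r Q
  intro hbot
  have h1 : F ≤ thompson r Q := le_sSup hF
  rw [hbot, le_bot_iff] at h1
  have h2 := hF.2.2 _ (zOmega_le r Q) (isElementaryAbelian_zOmega r Q)
  rw [h1, card_bot] at h2
  exact h ((card_le_one_iff_eq_bot _).1 h2)

theorem zOmega_ne_bot {r : ℕ} (hr : r.Prime) {Q : Subgroup G} (hQ : IsPGroup r Q) (h : Q ≠ ⊥) :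
    zOmega r Q ≠ ⊥ := by
  have := Fact.mk hr
  have hnt : Nontrivial Q := (nontrivial_iff_ne_bot Q).2 h
  have hc : Nontrivial (center Q) := hQ.center_nontrivial
  have hcp : IsPGroup r (center Q) := hQ.to_subgroup _
  obtain ⟨n, hn, hcard⟩ := hcp.nontrivial_iff_card.1 hc
  obtain ⟨z, hz⟩ := exists_prime_orderOf_dvd_card' r (G := center Q)
    (by rw [hcard]; exact dvd_pow_self r hn.ne')
  intro hbot
  have hzm : ((z : Q) : G) ∈ zOmega r Q := by
    refine ⟨z.1.2, fun q hq => ?_, ?_⟩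
    · exact congrArg Subtype.val ((mem_center_iff.1 z.2 ⟨q, hq⟩).symm)
    · have h1 : z ^ r = 1 := by rw [← hz]; exact pow_orderOf_eq_one z
      exact congrArg (fun w : center Q => ((w : Q) : G)) h1
  rw [hbot, mem_bot] at hzm
  have hz1 : z = 1 := Subtype.ext (Subtype.ext hzm)
  rw [hz1, orderOf_one] at hz
  exact hr.one_lt.ne hz

theorem card_mul_card_le (F M : Subgroup G) :
    Nat.card F * Nat.card M ≤ Nat.card ↥(F ⊔ M) * Nat.card ↥(F ⊓ M) := by
  have h1 := relIndex_mul_relIndex ⊥ M (F ⊔ M) bot_le le_sup_right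
  have h2 := relIndex_mul_relIndex ⊥ (M ⊓ F) F bot_le inf_le_right
  rw [relIndex_bot_left, relIndex_bot_left] at h1 h2
  rw [inf_relIndex_right] at h2
  have h3 : M.relIndex F ≤ M.relIndex (F ⊔ M) := relIndex_le_of_le_right le_sup_left
    (index_ne_zero_of_finite)
  rw [← h1, ← h2, inf_comm F M]
  calc _ = Nat.card M * M.relIndex F * Nat.card ↥(M ⊓ F) := by ring
    _ ≤ _ := by gcongr

end Thompson

section ThompsonReplacement

theorem eq_of_prime_dvd_card_isPGroup {G : Type*} [Group G] [Finite G] {p r : ℕ}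
    (hG : ∀ s, s.Prime → s ∣ Nat.card G → s = p ∨ s = r) {N : Subgroup G}
    (h : (Nat.card N).Coprime p) : IsPGroup r N := by
  refine IsPGroup.of_card (Nat.eq_prime_pow_of_unique_prime_dvd Nat.card_pos.ne' ?_)
  intro d hd hdN
  rcases hG d hd (hdN.trans (card_subgroup_dvd_card N)) with rfl | rfl
  · exact absurd (Nat.eq_one_of_dvd_coprimes h hdN dvd_rfl) hd.one_lt.ne'
  · rfl

variable {X A : Type*} [Group X] [CommGroup A] [Finite X] [Finite A] {p r : ℕ}

theorem map_eq_one_of_isLargestElementaryAbelian (hX : Group.IsSolvable X) (hp : p.Prime)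
    (hr : r.Prime) (hpr : p ≠ r) (hbad1 : ¬ (p = 2 ∧ r = 3)) (hbad2 : ¬ (p = 3 ∧ r = 2))
    (hprimes : ∀ s, s.Prime → s ∣ Nat.card X → s = p ∨ s = r)
    (ρ : X →* MulAut A) (ι : A →* X) (hι : Function.Injective ι)
    (hρ : ∀ x a, ι (ρ x a) = x * ι a * x⁻¹) (hA : ∀ a : A, a ^ r = 1)
    (hgen : ∀ B : Subgroup A,
      (∀ a, (∃ S : Sylow r X, ∀ s ∈ S, ρ s a = a) → a ∈ B) → B = ⊤)
    {Q E : Subgroup X} (hAQ : ι.range ≤ Q) (hE : IsLargestElementaryAbelian r Q E) :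
    E ≤ ρ.ker := by
  have := Fact.mk hr
  by_contra hEker
  let Y := ρ.range
  let σ : X →* Y := ρ.rangeRestrict
  have hσ : Function.Surjective σ := ρ.rangeRestrict_surjective
  have hσker : σ.ker = ρ.ker := ρ.ker_rangeRestrict
  have hYs : Group.IsSolvable Y := Group.isSolvable_of_surjective hσ
  have hYcard : Nat.card Y ∣ Nat.card X := card_range_dvd ρ
  have hYr : pCore r Y = ⊥ := by
    rw [eq_bot_iff]
    intro y hy
    have hn := pCore_normal r (G := Y)
    have hB : fixedSubgroup A (pCore r Y) = ⊤ := by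
      refine hgen _ ?_
      rintro a ⟨S, hS⟩ e he
      have h1 := le_sylow_of_normal (pCore_isPGroup (G := Y) r) (S.mapSurjective hσ) he
      have h2 : e ∈ (S : Subgroup X).map σ := h1
      obtain ⟨s, hs, rfl⟩ := h2
      exact hS s hs
    rw [mem_bot]
    refine Subtype.ext (MulEquiv.ext fun a => ?_)
    have : a ∈ fixedSubgroup A (pCore r Y) := by rw [hB]; trivial
    exact this y hy
  have hYp : pPrimeCore p Y = ⊥ := by
    rw [eq_bot_iff, ← hYr]
    refine le_pCore (pPrimeCore_normal p) (eq_of_prime_dvd_card_isPGroup (p := p) ?_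
      (pPrimeCore_coprime p))
    exact fun s hs hsY => hprimes s hs (hsY.trans hYcard)
  have hT := centralizer_pCore_le hYs hp hYp
  have hcomm : ∀ e ∈ E.map σ, ∀ f ∈ E.map σ, e * f = f * e := by
    rintro _ ⟨e, he, rfl⟩ _ ⟨f, hf, rfl⟩
    rw [← map_mul, hE.2.1.1 e he f hf, map_mul]
  have hpow : ∀ e ∈ E.map σ, e ^ r = 1 := by
    rintro _ ⟨e, he, rfl⟩
    rw [← map_pow, hE.2.1.2 e he, map_one]
  have hcardmap : ∀ F : Subgroup X, Nat.card (F.map σ) * Nat.card ↥(σ.ker ⊓ F) = Nat.card F := by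
    intro F
    have h1 := relIndex_mul_relIndex ⊥ (σ.ker ⊓ F) F bot_le inf_le_right
    rw [relIndex_bot_left, relIndex_bot_left, inf_relIndex_right, relIndex_ker] at h1
    rw [← h1, mul_comm]
  refine no_offender (Y := Y) (A := A) hp hr hpr hbad1 hbad2 hA (pCore_normal p)
    (pCore_isPGroup p) hcomm hpow ?_ ?_ ?_
  · intro e he hcen
    have h1 : e ∈ pCore p Y := hT (mem_centralizer_iff.2 fun t ht => (hcen t ht).symm)
    obtain ⟨k, hk⟩ := pCore_isPGroup (G := Y) p ⟨e, h1⟩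
    have hk' : e ^ p ^ k = 1 := congrArg Subtype.val hk
    have h2 : (p ^ k).Coprime r := Nat.Coprime.pow_left k ((Nat.coprime_primes hp hr).2 hpr)
    have h3 := Nat.dvd_gcd (orderOf_dvd_of_pow_eq_one hk') (orderOf_dvd_of_pow_eq_one (hpow e he))
    rw [h2] at h3
    exact orderOf_eq_one_iff.1 (Nat.dvd_one.1 h3)
  · intro h
    rw [Subgroup.map_eq_bot_iff, hσker] at h
    exact hEker h
  · intro E₀ hE₀
    let F := E ⊓ E₀.comap σ
    have hFmap : F.map σ = E₀ := by
      apply le_antisymm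
      · rintro _ ⟨f, hf, rfl⟩
        exact hf.2
      · intro e he
        obtain ⟨f, hf, rfl⟩ := hE₀ he
        exact ⟨f, ⟨hf, he⟩, rfl⟩
    have hkerF : σ.ker ⊓ F = σ.ker ⊓ E := by
      apply le_antisymm (inf_le_inf_left _ inf_le_left)
      intro x hx
      refine ⟨hx.1, hx.2, ?_⟩
      have : σ x = 1 := hx.1
      change σ x ∈ E₀
      rw [this]
      exact one_mem _
    let B := (fixedSubgroup A E₀).map ι
    have hFB : ∀ f ∈ F, ∀ b ∈ B, f * b = b * f := by
      rintro f hf _ ⟨a, ha, rfl⟩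
      have h1 : ρ f a = a := ha (σ f) hf.2
      have h2 := hρ f a
      rw [h1] at h2
      conv_rhs => rw [h2]
      group
    have hFBsup : ∀ g ∈ F ⊔ B, ∃ f ∈ F, ∃ b ∈ B, f * b = g := by
      intro g hg
      refine exists_mul_of_mem_sup (fun x hx y hy => ?_) hg
      rw [hFB x hx y hy, mul_inv_cancel_right]
      exact hy
    have hBcomm : ∀ a ∈ B, ∀ b ∈ B, a * b = b * a := by
      rintro _ ⟨a, -, rfl⟩ _ ⟨b, -, rfl⟩
      rw [← map_mul, mul_comm, map_mul]
    have hFBe : IsElementaryAbelian r (F ⊔ B) := by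
      constructor
      · intro g hg g' hg'
        obtain ⟨f, hf, b, hb, rfl⟩ := hFBsup g hg
        obtain ⟨f', hf', b', hb', rfl⟩ := hFBsup g' hg'
        have c1 : Commute f f' := hE.2.1.1 f hf.1 f' hf'.1
        have c2 : Commute f b' := hFB f hf b' hb'
        have c3 : Commute b f' := (hFB f' hf' b hb).symm
        have c4 : Commute b b' := hBcomm b hb b' hb'
        exact (c1.mul_right c2).mul_left (c3.mul_right c4)
      · intro g hg
        obtain ⟨f, hf, b, hb, rfl⟩ := hFBsup g hg
        rw [(show Commute f b from hFB f hf b hb).mul_pow, hE.2.1.2 f hf.1]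
        obtain ⟨a, -, rfl⟩ := hb
        rw [← map_pow, hA, map_one, one_mul]
    have hle : Nat.card ↥(F ⊔ B) ≤ Nat.card E :=
      hE.2.2 _ (sup_le (inf_le_left.trans hE.1) ((map_le_range _ _).trans hAQ)) hFBe
    have hinf : F ⊓ B ≤ (fixedSubgroup A (E.map σ)).map ι := by
      rintro _ ⟨hf, a, ha, rfl⟩
      refine mem_map_of_mem ι ?_
      rintro _ ⟨e, he, rfl⟩
      change ρ e a = a
      apply hι
      rw [hρ, hE.2.1.1 e he _ hf.1, mul_inv_cancel_right]
    have hinf' := card_le_of_le hinf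
    rw [card_map_of_injective' ι hι] at hinf'
    have h1 := card_mul_card_le F B
    rw [card_map_of_injective' ι hι, ← hcardmap F, hFmap, hkerF] at h1
    rw [← hcardmap E] at hle
    have hpos : 0 < Nat.card ↥(σ.ker ⊓ E) := Nat.card_pos
    have h2 := h1.trans (Nat.mul_le_mul hle hinf')
    refine Nat.le_of_mul_le_mul_left ?_ hpos
    calc _ = _ := by ring
      _ ≤ _ := h2
      _ = _ := by ring

end ThompsonReplacement

section ThompsonCentralizes

variable {G : Type*} [Group G] [Finite G] {p r : ℕ} {X V : Subgroup G} [hXn : X.Normal]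
  [hVn : V.Normal]

theorem thompson_le_centralizer (hX : Group.IsSolvable X) (hp : p.Prime)
    (hr : r.Prime) (hpr : p ≠ r) (hbad1 : ¬ (p = 2 ∧ r = 3)) (hbad2 : ¬ (p = 3 ∧ r = 2))
    (hprimes : ∀ s, s.Prime → s ∣ Nat.card X → s = p ∨ s = r)
    (S : Sylow r X) (hVe : IsElementaryAbelian r V) (hVS : V ≤ (S : Subgroup X).map X.subtype)
    {Z : Set G} (hZ : V = normalClosure Z) (hZS : ∀ z ∈ Z, ∀ s ∈ S, (s : G) * z = z * s) :
    thompson r ((S : Subgroup X).map X.subtype) ≤ centralizer (V : Set G) := by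
  have hVX : V ≤ X := hVS.trans (map_subtype_le _)
  refine sSup_le fun E hE => ?_
  obtain ⟨E, -, rfl⟩ := exists_map_eq_of_le_map hE.1 X.subtype_injective
  replace hE := (isLargestElementaryAbelian_map_iff X.subtype_injective).1 hE
  let cV : CommGroup V :=
    { (inferInstance : Group V) with
      mul_comm := fun a b => Subtype.ext (hVe.1 a a.2 b b.2) }
  have key : E ≤ ((MulAut.conjNormal : G →* MulAut V).comp X.subtype).ker := by
    refine map_eq_one_of_isLargestElementaryAbelian (A := V) hX hp hr hpr hbad1 hbad2 hprimes
      ((MulAut.conjNormal : G →* MulAut V).comp X.subtype) (inclusion hVX)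
      (inclusion_injective hVX) ?_ ?_ ?_ (Q := S) ?_ hE
    · intro x a
      exact Subtype.ext (MulAut.conjNormal_apply (x : G) a)
    · exact fun a => Subtype.ext (hVe.2 a a.2)
    · intro B hB
      have hle : V ≤ B.map V.subtype := by
        conv_lhs => rw [hZ]
        unfold normalClosure
        rw [closure_le]
        intro c hc
        obtain ⟨z, hz, hzc⟩ := Group.mem_conjugatesOfSet_iff.1 hc
        obtain ⟨g, rfl⟩ := isConj_iff.1 hzc
        have hzV : z ∈ V := by rw [hZ]; exact subset_normalClosure hz
        refine ⟨⟨g * z * g⁻¹, hVn.conj_mem z hzV g⟩,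
          hB _ ⟨(MulAut.conjNormal g : MulAut X) • S, ?_⟩, rfl⟩
        intro s hs
        have h1 : (MulAut.conjNormal g : MulAut X)⁻¹ • s ∈ (S : Subgroup X) :=
          mem_pointwise_smul_iff_inv_smul_mem.1 hs
        have h2 := hZS z hz _ h1
        have h3 : (((MulAut.conjNormal g : MulAut X)⁻¹ • s : X) : G) = g⁻¹ * s * g := by
          rw [← map_inv, MulAut.smul_def, MulAut.conjNormal_apply, inv_inv]
        rw [h3] at h2
        apply Subtype.ext
        refine (MulAut.conjNormal_apply (s : G) _).trans ?_
        change (s : G) * (g * z * g⁻¹) * (s : G)⁻¹ = g * z * g⁻¹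
        have h4 : (s : G) * (g * z * g⁻¹) * (s : G)⁻¹ =
          g * (g⁻¹ * s * g * z) * g⁻¹ * (s : G)⁻¹ := by group
        rw [h4, h2]
        group
      rw [eq_top_iff]
      intro v _
      obtain ⟨b, hb, hbv⟩ := hle v.2
      rwa [← Subtype.ext hbv]
    · rintro _ ⟨v, rfl⟩
      obtain ⟨s, hs, hsv⟩ := hVS v.2
      have : inclusion hVX v = s := Subtype.ext hsv.symm
      rw [this]; exact hs
  rintro _ ⟨e, he, rfl⟩
  rw [mem_centralizer_iff]
  intro v hv
  have h1 : (MulAut.conjNormal (e : G) : MulAut V) = 1 := key he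
  have h2 := MulAut.conjNormal_apply (e : G) (⟨v, hv⟩ : V)
  rw [h1, MulAut.one_apply] at h2
  change v = (e : G) * v * (e : G)⁻¹ at h2
  change v * (e : G) = (e : G) * v
  conv_lhs => rw [h2]
  group

end ThompsonCentralizes

section Frattini

variable {G : Type*} [Group G]

theorem map_mem_normalizer_map_iff {Γ : Type*} [Group Γ] {f : Γ →* G}
    (hf : Function.Injective f) {N : Subgroup Γ} {γ : Γ} :
    f γ ∈ normalizer (N.map f : Set G) ↔ γ ∈ normalizer (N : Set Γ) := by
  rw [mem_normalizer_iff, mem_normalizer_iff]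
  constructor
  · intro h x
    have := h (f x)
    rwa [← map_mul, ← map_inv, ← map_mul, mem_map_iff_mem hf, mem_map_iff_mem hf] at this
  · have key : ∀ γ : Γ, (∀ x, x ∈ N ↔ γ * x * γ⁻¹ ∈ N) → ∀ y ∈ N.map f,
        f γ * y * (f γ)⁻¹ ∈ N.map f := by
      rintro γ h _ ⟨x, hx, rfl⟩
      exact ⟨γ * x * γ⁻¹, (h x).1 hx, by simp⟩
    intro h y
    refine ⟨key γ h y, fun hy => ?_⟩
    have h1 := key γ⁻¹ (fun x => by rw [h (γ⁻¹ * x * γ⁻¹⁻¹)]; simp [mul_assoc]) _ hy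
    simpa [mul_assoc] using h1

theorem map_conj_eq_iff_mem_normalizer {N : Subgroup G} {g : G} :
    g ∈ normalizer (N : Set G) ↔ N.map (MulAut.conj g).toMonoidHom = N := by
  rw [mem_normalizer_iff]
  constructor
  · intro h
    ext y
    constructor
    · rintro ⟨x, hx, rfl⟩
      exact (h x).1 hx
    · intro hy
      exact ⟨g⁻¹ * y * g, (h _).2 (by simpa [mul_assoc] using hy), by simp [mul_assoc]⟩
  · intro h x
    constructor
    · intro hx
      rw [← h]
      exact ⟨x, hx, rfl⟩
    · intro hx
      rw [← h] at hx
      obtain ⟨y, hy, hyx⟩ := hx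
      have : y = x := (MulAut.conj g).injective hyx
      rwa [← this]

theorem normalizer_le_normalizer_thompson (r : ℕ) (Q : Subgroup G) :
    normalizer (Q : Set G) ≤ normalizer (thompson r Q : Set G) := by
  intro g hg
  rw [map_conj_eq_iff_mem_normalizer] at hg ⊢
  rw [map_thompson (MulAut.conj g).injective, hg]

variable [Finite G] {r : ℕ} [Fact r.Prime] {X C : Subgroup G} [hC : C.Normal]

theorem exists_sylow_map_eq_inf (hCX : C ≤ X) (S : Sylow r X) :
    ∃ P : Sylow r C, (P : Subgroup C).map C.subtype = (S : Subgroup X).map X.subtype ⊓ C := by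
  have hS : IsPGroup r ((S : Subgroup X).map X.subtype) := S.2.map _
  obtain ⟨P, hP⟩ := (hS.comap_subtype (K := C)).exists_le_sylow
  refine ⟨P, ?_⟩
  have h1 : (S : Subgroup X).map X.subtype ⊓ C ≤ (P : Subgroup C).map C.subtype := by
    rintro x ⟨hx, hxC⟩
    exact ⟨⟨x, hxC⟩, hP hx, rfl⟩
  refine (eq_of_le_of_card_ge h1 ?_).symm
  have h2 : IsPGroup r (((P : Subgroup C).map C.subtype).comap X.subtype) :=
    (P.2.map C.subtype).comap_subtype
  obtain ⟨S', hS'⟩ := h2.exists_le_sylow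
  obtain ⟨x, rfl⟩ := MulAction.exists_smul_eq X S S'
  have h3 : (P : Subgroup C).map C.subtype ≤
      ((S : Subgroup X).map X.subtype ⊓ C).map (MulAut.conj (x : G)).toMonoidHom := by
    rintro _ ⟨c, hc, rfl⟩
    have h4 : (⟨c, hCX c.2⟩ : X) ∈ ((x • S : Sylow r X) : Subgroup X) := hS' ⟨c, hc, rfl⟩
    rw [Sylow.coe_subgroup_smul] at h4
    obtain ⟨s, hs, hsc⟩ := h4
    have h5 : (x : G) * s * (x : G)⁻¹ = c := congrArg Subtype.val hsc
    refine ⟨s, ⟨⟨s, hs, rfl⟩, ?_⟩, h5⟩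
    have h6 : (s : G) = (x : G)⁻¹ * c * (x : G)⁻¹⁻¹ := by rw [← h5]; group
    rw [h6]
    exact hC.conj_mem _ c.2 _
  refine (card_le_of_le h3).trans_eq ?_
  exact card_map_of_injective' _ (MulAut.conj (x : G)).injective _

theorem normalizer_thompson_sup_eq_top (hCX : C ≤ X) (S : Sylow r X)
    (h : thompson r ((S : Subgroup X).map X.subtype) ≤ C) :
    normalizer (thompson r ((S : Subgroup X).map X.subtype) : Set G) ⊔ C = ⊤ := by
  obtain ⟨P, hP⟩ := exists_sylow_map_eq_inf hCX S
  rw [← thompson_eq_of_le inf_le_left (le_inf (thompson_le _ _) h), ← hP, eq_top_iff,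
    ← Sylow.normalizer_sup_eq_top P]
  exact sup_le_sup_right (normalizer_le_normalizer_thompson _ _) _

end Frattini

section Supplement

variable {p : ℕ} {G Γ : Type} [Group G] [Group Γ] {i j : Γ →* G} {X : Subgroup G}

theorem isCoatom_of_isCoatom_subgroupOf [Finite G] {K M : Subgroup G} (hK : K ≠ ⊤)
    (hidx : (K.subgroupOf M).index = K.index) (h : IsCoatom (K.subgroupOf M)) : IsCoatom K := by
  have hidx' : K.relIndex M = K.index := hidx
  have hle : ∀ A B : Subgroup G, A.relIndex B ≤ A.index := by
    intro A B
    rw [← relIndex_top_right]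
    exact relIndex_le_of_le_right le_top index_ne_zero_of_finite
  refine ⟨hK, fun L hL => ?_⟩
  have hmul := relIndex_mul_index hL.le
  have hpos : 0 < K.index := Nat.pos_of_ne_zero index_ne_zero_of_finite
  rcases h.le_iff.1 (subgroupOf_mono M hL.le) with h1 | h1
  · have hML : M ≤ L := subgroupOf_eq_top.1 h1
    have h2 : K.relIndex M ≤ K.relIndex L :=
      relIndex_le_of_le_right hML index_ne_zero_of_finite
    rw [hidx', ← hmul] at h2
    have h3 : 0 < K.relIndex L := Nat.pos_of_ne_zero index_ne_zero_of_finite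
    have h4 : L.index ≤ 1 := Nat.le_of_mul_le_mul_left (by rwa [mul_one]) h3
    have h5 : L.index ≠ 0 := index_ne_zero_of_finite
    exact index_eq_one.1 (by omega)
  · exfalso
    have h2 : L.relIndex M = K.relIndex M := by unfold relIndex; rw [h1]
    have h3 := hle L M
    rw [h2, hidx', ← hmul] at h3
    have h5 : 0 < L.index := Nat.pos_of_ne_zero index_ne_zero_of_finite
    have h4 : K.relIndex L ≤ 1 := Nat.le_of_mul_le_mul_right (by rwa [one_mul]) h5
    have h6 : K.relIndex L ≠ 0 := index_ne_zero_of_finite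
    exact hL.not_ge (relIndex_eq_one.1 (by omega))

theorem subgroupOf_eq_comap_map {H C M : Subgroup G} [C.Normal] (hCH : C ≤ H) :
    H.subgroupOf M =
      (H.map (QuotientGroup.mk' C)).comap ((QuotientGroup.mk' C).comp M.subtype) := by
  rw [← comap_comap, comap_map_eq, QuotientGroup.ker_mk', sup_eq_left.2 hCH]
  rfl

theorem mk_comp_subtype_surjective {C M : Subgroup G} [hC : C.Normal] (hMC : M ⊔ C = ⊤) :
    Function.Surjective ((QuotientGroup.mk' C).comp M.subtype) := by
  intro q
  induction q using QuotientGroup.induction_on with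
  | H g =>
    have hg : g ∈ M ⊔ C := by rw [hMC]; trivial
    obtain ⟨m, hm, c, hc, rfl⟩ := exists_mul_of_mem_sup (fun x _ y hy => hC.conj_mem y hy x) hg
    refine ⟨⟨m, hm⟩, ?_⟩
    exact (QuotientGroup.eq.2 (by simpa using hc))

variable [Finite G]

namespace IsMaximalPair

theorem isCoatom_of_supplement (h : IsMaximalPair p i j X)
    (hIH : MaximalPairsBelow p (Nat.card G + Nat.card X)) {M C : Subgroup G} [hC : C.Normal]
    (hM : M ≠ ⊤) (hMC : M ⊔ C = ⊤) (hCi : C ≤ i.range) (hCX : C ≤ X)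
    (hmem : ∀ γ, i γ ∈ M ↔ j γ ∈ M) : IsCoatom j.range := by
  have hXn := h.normal
  have hsol := h.isSolvable
  let i' : M.comap i →* M := (i.comp (M.comap i).subtype).codRestrict M fun γ => γ.2
  let j' : M.comap i →* M :=
    (j.comp (M.comap i).subtype).codRestrict M fun γ => (hmem _).1 γ.2
  have hi' : Function.Injective i' := by
    intro a b hab
    exact Subtype.ext (h.injective_left (congrArg Subtype.val hab))
  have hj' : Function.Injective j' := by
    intro a b hab
    exact Subtype.ext (h.injective_right (congrArg Subtype.val hab))
  have hir : i'.range = i.range.subgroupOf M := by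
    ext x
    constructor
    · rintro ⟨y, rfl⟩
      exact ⟨y, rfl⟩
    · rintro ⟨y, hy⟩
      exact ⟨⟨y, by rw [mem_comap, hy]; exact x.2⟩, Subtype.ext hy⟩
  have hjr : j'.range = j.range.subgroupOf M := by
    ext x
    constructor
    · rintro ⟨y, rfl⟩
      exact ⟨y, rfl⟩
    · rintro ⟨y, hy⟩
      exact ⟨⟨y, by rw [mem_comap, hmem, hy]; exact x.2⟩, Subtype.ext hy⟩
  have hsurj := mk_comp_subtype_surjective hMC
  have hidx : i'.range.index = i.range.index := by
    rw [hir, subgroupOf_eq_comap_map hCi, index_comap_of_surjective _ hsurj,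
      index_map_eq _ (QuotientGroup.mk'_surjective C)
      (by rw [QuotientGroup.ker_mk']; exact hCi)]
  have key : IsMaximalPair p i' j' (X.subgroupOf M) :=
    { isSolvable := inferInstance
      prime := h.prime
      injective_left := hi'
      injective_right := hj'
      normal := inferInstance
      isCoatom := by
        rw [hir, subgroupOf_eq_comap_map hCi]
        refine isCoatom_comap_of_surjective hsurj ?_
        exact isCoatom_map_of_surjective (QuotientGroup.mk'_surjective C)
          (by rw [QuotientGroup.ker_mk']; exact hCi) h.isCoatom
      index_eq := by rw [hidx]; exact h.index_eq
      not_le := by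
        rw [hir]
        intro hle
        refine h.not_le fun x hx => ?_
        have hx' : x ∈ M ⊔ C := by rw [hMC]; trivial
        obtain ⟨m, hm, c, hc, rfl⟩ :=
          exists_mul_of_mem_sup (fun x _ y hy => hC.conj_mem y hy x) hx'
        have hmX : m ∈ X := by
          have := mul_mem hx (inv_mem (hCX hc))
          simpa using this
        have hmi : (⟨m, hm⟩ : M) ∈ i.range.subgroupOf M := hle (mem_subgroupOf.2 hmX)
        exact mul_mem (mem_subgroupOf.1 hmi) (hCi hc)
      mem_iff := fun γ => h.mem_iff γ
      good := by
        intro r hr hrd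
        refine h.good r hr (hrd.trans ?_)
        rw [← card_map_of_injective' _ M.subtype_injective, subgroupOf_map_subtype]
        exact card_dvd_of_le inf_le_left }
  have hlt : Nat.card M + Nat.card (X.subgroupOf M) < Nat.card G + Nat.card X := by
    have h1 : Nat.card (X.subgroupOf M) ≤ Nat.card X := by
      rw [← card_map_of_injective' _ M.subtype_injective, subgroupOf_map_subtype]
      exact card_le_of_le inf_le_left
    have h2 : Nat.card M < Nat.card G := by
      refine lt_of_le_of_ne (card_le_card_group M) fun h => hM ?_
      exact (card_eq_iff_eq_top M).1 h
    omega
  have hco := hIH _ _ i' j' _ hlt key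
  refine isCoatom_of_isCoatom_subgroupOf (M := M)
    (range_ne_top h.injective_left h.injective_right h.isCoatom.1) ?_ (by rwa [← hjr])
  rw [← hjr, index_range_eq hi' hj', hidx, index_range_eq h.injective_left h.injective_right]

/-- The case in which the Thompson subgroup of a common Sylow subgroup can be used. -/
theorem isCoatom_of_map_eq (h : IsMaximalPair p i j X)
    (hIH : MaximalPairsBelow p (Nat.card G + Nat.card X)) {r : ℕ} (hr : r.Prime) (hrp : r ≠ p)
    (hrX : r ∣ Nat.card X) (hbot : pPrimeCore r X = ⊥)
    (hprimes : ∀ s, s.Prime → s ∣ Nat.card X → s = p ∨ s = r)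
    (S : Sylow r X) (D : Subgroup Γ) (hDi : D.map i = (S : Subgroup X).map X.subtype)
    (hDj : D.map j = (S : Subgroup X).map X.subtype) : IsCoatom j.range := by
  have := Fact.mk hr
  have hXn := h.normal
  have hsol := h.isSolvable
  have hXsol : Group.IsSolvable X := inferInstance
  have hi := h.injective_left
  have hj := h.injective_right
  set Q : Subgroup G := (S : Subgroup X).map X.subtype with hQ
  have hQX : Q ≤ X := map_subtype_le _
  have hQr : IsPGroup r Q := S.2.map X.subtype
  have hQne : Q ≠ ⊥ := by
    rw [hQ, Ne, map_eq_bot_iff_of_injective _ X.subtype_injective]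
    intro h0
    have h1 := S.card_eq_multiplicity
    rw [h0, card_bot] at h1
    have h2 : 0 < (Nat.card X).factorization r :=
      hr.factorization_pos_of_dvd Nat.card_pos.ne' hrX
    exact (Nat.one_lt_pow h2.ne' hr.one_lt).ne h1
  -- the largest normal `r`-subgroup of `X`
  have hcore_normal := pCore_normal r (G := X)
  have hcore_char := pCore_characteristic r (G := X)
  let R : Subgroup G := (pCore r X).map X.subtype
  have hRn : R.Normal := inferInstance
  have hRQ : R ≤ Q := map_mono (le_sylow_of_normal (pCore_isPGroup r) S)
  have hCR : ∀ x ∈ X, (∀ y ∈ R, x * y = y * x) → x ∈ R := by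
    intro x hx hxy
    refine ⟨⟨x, hx⟩, centralizer_pCore_le hXsol hr hbot (mem_centralizer_iff.2 fun y hy => ?_), rfl⟩
    exact Subtype.ext (hxy y (mem_map_of_mem X.subtype hy)).symm
  let Z := zOmega r Q
  have hZne : Z ≠ ⊥ := zOmega_ne_bot hr hQr hQne
  have hZR : Z ≤ zOmega r R := fun z hz =>
    ⟨hCR z (hQX hz.1) fun y hy => hz.2.1 y (hRQ hy), fun y hy => hz.2.1 y (hRQ hy), hz.2.2⟩
  have hΩn : (zOmega r R).Normal := by
    refine ⟨fun z hz g => ⟨hRn.conj_mem z hz.1 g, fun q hq => ?_, ?_⟩⟩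
    · have h1 := hz.2.1 _ (hRn.conj_mem q hq g⁻¹)
      have e1 : g * z * g⁻¹ * q = g * (z * (g⁻¹ * q * g⁻¹⁻¹)) * g⁻¹ := by group
      rw [e1, h1]
      group
    · rw [conj_pow, hz.2.2, mul_one, mul_inv_cancel]
  let V : Subgroup G := normalClosure (Z : Set G)
  have hVn : V.Normal := normalClosure_normal
  have hZV : Z ≤ V := le_normalClosure
  have hVΩ : V ≤ zOmega r R := normalClosure_le_normal hZR
  have hVR : V ≤ R := hVΩ.trans (zOmega_le r R)
  have hVe : IsElementaryAbelian r V :=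
    ⟨fun a ha b hb => (hVΩ ha).2.1 b (hVR hb), fun a ha => (hVΩ ha).2.2⟩
  have hVne : V ≠ ⊥ := fun h0 => hZne (le_bot_iff.1 (h0 ▸ hZV))
  let C : Subgroup G := X ⊓ centralizer (V : Set G)
  have hCn : C.Normal := inferInstance
  have hΓfin : Finite Γ := Finite.of_injective i hi
  by_cases hCi : C ≤ i.range
  · have hgood := h.good r hr hrX
    have hJcen : thompson r Q ≤ centralizer (V : Set G) := by
      refine thompson_le_centralizer (hXn := hXn) (hVn := hVn) (p := p) hXsol h.prime hr hrp.symm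
        hgood.1 hgood.2 hprimes S hVe (hVR.trans hRQ) rfl ?_
      intro z hz s hs
      exact (hz.2.1 s (mem_map_of_mem X.subtype hs)).symm
    have hJC : thompson r Q ≤ C := le_inf ((thompson_le r Q).trans hQX) hJcen
    have hmem : ∀ γ, i γ ∈ thompson r Q ↔ j γ ∈ thompson r Q := by
      intro γ
      rw [← mem_comap, ← mem_comap]
      conv_lhs => rw [← hDi, ← map_thompson hi, comap_map_of_injective hi]
      conv_rhs => rw [← hDj, ← map_thompson hj, comap_map_of_injective hj]
    by_cases hN : normalizer (thompson r Q : Set G) = ⊤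
    · have hJn : (thompson r Q).Normal := normalizer_eq_top_iff.1 hN
      refine h.isCoatom_of_normal_le hIH (thompson_ne_bot hZne) (hJC.trans hCi) hmem
    · refine h.isCoatom_of_supplement hIH (C := C) hN ?_ hCi inf_le_left ?_
      · exact normalizer_thompson_sup_eq_top inf_le_left S hJC
      · intro γ
        conv_lhs => rw [← hDi, ← map_thompson hi, map_mem_normalizer_map_iff hi]
        conv_rhs => rw [← hDj, ← map_thompson hj, map_mem_normalizer_map_iff hj]
  · have hHC : i.range ⊔ C = ⊤ := by
      rcases h.isCoatom.le_iff.1 (le_sup_left : i.range ≤ i.range ⊔ C) with h1 | h1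
      · exact h1
      · exact absurd (h1 ▸ le_sup_right) hCi
    let W : Subgroup Γ := normalClosure (zOmega r D : Set Γ)
    have hWn : W.Normal := normalClosure_normal
    have hWle : ∀ f : Γ →* G, Function.Injective f → D.map f = Q → W.map f ≤ V := by
      intro f hf hDf
      rw [map_le_iff_le_comap]
      refine normalClosure_le_normal fun z hz => ?_
      apply hZV
      have := mem_map_of_mem f hz
      rwa [map_zOmega hf, hDf] at this
    have hWi : W.map i = V := by
      refine le_antisymm (hWle i hi hDi) ?_
      have hn : (W.map i).Normal := by
        refine ⟨fun w hw g => ?_⟩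
        have hg : g ∈ i.range ⊔ C := by rw [hHC]; trivial
        obtain ⟨_, ⟨γ, rfl⟩, c, hc, rfl⟩ :=
          exists_mul_of_mem_sup (fun x _ y hy => hCn.conj_mem y hy x) hg
        have hcw : c * w = w * c :=
          ((mem_centralizer_iff.1 hc.2) w (hWle i hi hDi hw)).symm
        have e1 : i γ * c * w * (i γ * c)⁻¹ = i γ * (c * w) * c⁻¹ * (i γ)⁻¹ := by group
        rw [e1, hcw]
        obtain ⟨w, hw, rfl⟩ := hw
        refine ⟨γ * w * γ⁻¹, hWn.conj_mem w hw γ, ?_⟩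
        simp [mul_assoc]
      refine normalClosure_le_normal ?_
      intro z hz
      have hz' : z ∈ zOmega r Q := hz
      rw [← hDi, ← map_zOmega hi] at hz'
      exact map_mono (f := i) (le_normalClosure : zOmega r D ≤ W) hz'
    have hWj : W.map j = V := by
      refine eq_of_le_of_card_ge (hWle j hj hDj) ?_
      rw [← hWi, card_map_of_injective' i hi, card_map_of_injective' j hj]
    refine h.isCoatom_of_normal_le hIH hVne ?_ ?_
    · rw [← hWi]; exact map_le_range _ _
    · intro γ
      rw [← mem_comap, ← mem_comap]
      conv_lhs => rw [← hWi, comap_map_of_injective hi]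
      conv_rhs => rw [← hWj, comap_map_of_injective hj]

end IsMaximalPair

end Supplement

section Conjugation

variable {p : ℕ} {G Γ : Type} [Group G] [Group Γ] {i j : Γ →* G} {X : Subgroup G}

theorem exists_sylow_map_eq_map_map [Finite G] {r : ℕ} [Fact r.Prime] {f : Γ →* G}
    (hf : Function.Injective f) {Δ : Subgroup Γ} (hΔ : Δ.map f ≤ X)
    (hcard : (Nat.card Δ).factorization r = (Nat.card X).factorization r) (S : Sylow r Δ) :
    ∃ T : Sylow r X, (T : Subgroup X).map X.subtype = ((S : Subgroup Δ).map Δ.subtype).map f := by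
  have hΓ : Finite Γ := Finite.of_injective f hf
  have hle : ((S : Subgroup Δ).map Δ.subtype).map f ≤ X :=
    (map_mono (map_subtype_le _)).trans hΔ
  have hmap : ((((S : Subgroup Δ).map Δ.subtype).map f).subgroupOf X).map X.subtype =
      ((S : Subgroup Δ).map Δ.subtype).map f := by
    rw [subgroupOf_map_subtype, inf_eq_left.2 hle]
  refine ⟨Sylow.ofCard ((((S : Subgroup Δ).map Δ.subtype).map f).subgroupOf X) ?_, hmap⟩
  rw [← card_map_of_injective' _ X.subtype_injective, hmap, card_map_of_injective' f hf,
    card_map_of_injective' _ Δ.subtype_injective, S.card_eq_multiplicity, hcard]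

theorem isCoatom_range_conj_comp_iff {x : G} :
    IsCoatom ((MulAut.conj x).toMonoidHom.comp j).range ↔ IsCoatom j.range := by
  have hs : Function.Surjective (MulAut.conj x).toMonoidHom := (MulAut.conj x).surjective
  have hker : (MulAut.conj x).toMonoidHom.ker ≤ j.range := by
    rw [(MonoidHom.ker_eq_bot_iff _).2 (MulAut.conj x).injective]
    exact bot_le
  rw [MonoidHom.range_comp]
  exact ⟨isCoatom_of_isCoatom_map hs hker, isCoatom_map_of_surjective hs hker⟩

theorem IsMaximalPair.conj_right (h : IsMaximalPair p i j X) (x : G) :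
    IsMaximalPair p i ((MulAut.conj x).toMonoidHom.comp j) X :=
  { h with
    injective_right := (MulAut.conj x).injective.comp h.injective_right
    mem_iff := fun γ => by
      rw [h.mem_iff]
      exact h.normal.mem_comm_iff.trans (by simp) |>.symm }

variable [Finite G]

namespace IsMaximalPair

theorem factorization_card_comap (h : IsMaximalPair p i j X) {r : ℕ} (hr : r.Prime)
    (hrp : r ≠ p) :
    (Nat.card (X.comap i)).factorization r = (Nat.card X).factorization r := by
  have hXn := h.normal
  obtain ⟨a, ha⟩ := h.index_eq
  have h1 : i.range.relIndex X ∣ p ^ a := by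
    rw [← ha, ← relIndex_sup_right_of_normal]
    exact relIndex_dvd_index_of_le le_sup_left
  have h2 : Nat.card (X.comap i) * i.range.relIndex X = Nat.card X := by
    rw [← card_map_of_injective' i h.injective_left, ← range_inf_eq_map_comap]
    have h4 := relIndex_mul_relIndex ⊥ (i.range ⊓ X) X bot_le inf_le_right
    rwa [inf_relIndex_right, relIndex_bot_left, relIndex_bot_left] at h4
  have hΓ : Finite Γ := Finite.of_injective i h.injective_left
  have h5 : i.range.relIndex X ≠ 0 := index_ne_zero_of_finite
  have h3 : (i.range.relIndex X).factorization r = 0 := by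
    refine Nat.factorization_eq_zero_of_not_dvd fun hd => hrp ?_
    exact (Nat.prime_dvd_prime_iff_eq hr h.prime).1 (hr.dvd_of_dvd_pow (hd.trans h1))
  rw [← h2, Nat.factorization_mul Nat.card_pos.ne' h5, Finsupp.add_apply, h3,
    add_zero]

theorem prime_eq_or_eq_of_dvd (h : IsMaximalPair p i j X)
    (hIH : MaximalPairsBelow p (Nat.card G + Nat.card X)) (hj : ¬ IsCoatom j.range)
    {r s : ℕ} (hr : r.Prime) (hrX : r ∣ Nat.card X) (hs : s.Prime) (hrp : r ≠ p)
    (hsX : s ∣ Nat.card X) : s = p ∨ s = r := by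
  by_contra! hne
  have hsol := h.isSolvable
  have hXsol : Group.IsSolvable X := inferInstance
  have hrb := h.pPrimeCore_eq_bot hIH hj hr hrp hrX
  have hsb := h.pPrimeCore_eq_bot hIH hj hs hne.1 hsX
  have hle : pCore r X ≤ pPrimeCore s X :=
    le_pPrimeCore (pCore_normal r)
      (coprime_card_of_isPGroup hr hs hne.2.symm (pCore_isPGroup r))
  have hbot : pCore r X = ⊥ := le_bot_iff.1 (hle.trans_eq hsb)
  have hcen := centralizer_pCore_le hXsol hr hrb
  rw [hbot] at hcen
  have htop : (⊤ : Subgroup X) ≤ ⊥ := by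
    refine le_trans (fun x _ => ?_) hcen
    rw [mem_centralizer_iff]
    rintro y hy
    rw [mem_bot.1 hy, one_mul, mul_one]
  have hc := card_le_of_le htop
  rw [card_top, card_bot] at hc
  exact hr.one_lt.not_ge ((Nat.le_of_dvd Nat.card_pos hrX).trans hc)

theorem _root_.maximalPairsBelow (p n : ℕ) : MaximalPairsBelow p n := by
  induction n with
  | zero => exact fun _ _ _ _ _ _ _ _ hlt => absurd hlt (Nat.not_lt_zero _)
  | succ n ih =>
    intro G Γ _ _ _ i j X hlt h
    have hIH : MaximalPairsBelow p (Nat.card G + Nat.card X) :=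
      fun G' Γ' _ _ _ i' j' X' hlt' h' => ih G' Γ' i' j' X' (by omega) h'
    by_contra hj
    have hXn := h.normal
    by_cases hX : ∃ r, r.Prime ∧ r ≠ p ∧ r ∣ Nat.card X
    · obtain ⟨r, hr, hrp, hrX⟩ := hX
      have := Fact.mk hr
      obtain ⟨S⟩ : Nonempty (Sylow r (X.comap i)) := inferInstance
      have hf := h.factorization_card_comap hr hrp
      obtain ⟨T, hT⟩ := exists_sylow_map_eq_map_map h.injective_left (map_comap_le i X) hf S
      have hle : (X.comap i).map j ≤ X := by
        rw [map_le_iff_le_comap]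
        exact fun γ hγ => (h.mem_iff γ).1 hγ
      obtain ⟨T', hT'⟩ := exists_sylow_map_eq_map_map h.injective_right hle hf S
      obtain ⟨x, hx⟩ := MulAction.exists_smul_eq X T' T
      refine hj (isCoatom_range_conj_comp_iff.1 ((h.conj_right (x : G)).isCoatom_of_map_eq hIH hr
        hrp hrX (h.pPrimeCore_eq_bot hIH hj hr hrp hrX)
        (fun s hs hsX => h.prime_eq_or_eq_of_dvd hIH hj hr hrX hs hrp hsX) T _ hT.symm ?_))
      rw [← map_map, ← hT', ← hx, Sylow.coe_subgroup_smul]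
      ext g
      constructor
      · rintro ⟨_, ⟨t, ht, rfl⟩, rfl⟩
        exact ⟨x * t * x⁻¹, ⟨t, ht, rfl⟩, rfl⟩
      · rintro ⟨_, ⟨t, ht, rfl⟩, rfl⟩
        exact ⟨t, ⟨t, ht, rfl⟩, rfl⟩
    · push Not at hX
      have hXp : IsPGroup p X := by
        refine IsPGroup.of_card (Nat.eq_prime_pow_of_unique_prime_dvd Nat.card_pos.ne' ?_)
        intro d hd hdX
        by_contra hdp
        exact hX d hd hdp hdX
      exact hj (isCoatom_range_of_isPGroup h.injective_left h.injective_right h.prime hXp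
        h.isCoatom h.not_le h.mem_iff)

theorem isCoatom_right (h : IsMaximalPair p i j X) : IsCoatom j.range :=
  maximalPairsBelow p _ G Γ i j X (Nat.lt_succ_self _) h

end IsMaximalPair

end Conjugation

theorem nonempty_mulEquiv_map_of_ker_eq {Γ G Q : Type*} [Group Γ] [Group G] [Group Q]
    {i j : Γ →* G} {π : G →* Q} (h : (π.comp i).ker = (π.comp j).ker) :
    Nonempty (i.range.map π ≃* j.range.map π) := by
  rw [← MonoidHom.range_comp, ← MonoidHom.range_comp]
  exact ⟨(QuotientGroup.quotientKerEquivRange (π.comp i)).symm.trans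
    ((QuotientGroup.quotientMulEquivOfEq h).trans
      (QuotientGroup.quotientKerEquivRange (π.comp j)))⟩

/-- **Theorem 2.3** (Glauberman–Robinson).  Let `H` be a maximal subgroup of the finite solvable
group `G` with `|G : H| = p ^ a`, `p` prime, `a ≥ 1`.  Let `K ≤ G` with `K ≅ H` and `K` not
maximal.  Then `p ≤ 3` and, for `q = 5 - p`, `O_{q'}(H) = O_{q'}(G) = O_{q'}(K)`; moreover, for
`G* = G / O_{q'}(G)` (realized as the image of a surjection `π` with kernel `O_{q'}(G)`),
the images `H*` and `K*` are isomorphic subgroups of `G*` with `H*` maximal and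
`K*` not maximal. -/
theorem glauberman_robinson_theoremA
    (G : Type) [Group G] [Finite G] (hG : IsSolvable G)
    (p a : ℕ) (hp : p.Prime) (ha : 0 < a)
    (H : Subgroup G) (hH : IsCoatom H) (hidx : H.index = p ^ a)
    (K : Subgroup G) (hiso : Nonempty (H ≃* K)) (hK : ¬ IsCoatom K) :
    p ≤ 3 ∧
    (pPrimeCore (5 - p) H).map H.subtype = pPrimeCore (5 - p) G ∧
    (pPrimeCore (5 - p) K).map K.subtype = pPrimeCore (5 - p) G ∧
    ∃ (Gs : Type) (_ : Group Gs) (π : G →* Gs),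
      Function.Surjective π ∧ π.ker = pPrimeCore (5 - p) G ∧
      Nonempty (H.map π ≃* K.map π) ∧
      IsCoatom (H.map π) ∧ ¬ IsCoatom (K.map π) := by
  obtain ⟨φ⟩ := hiso
  have hGs : Group.IsSolvable G := hG
  let i : H →* G := H.subtype
  let j : H →* G := K.subtype.comp φ.toMonoidHom
  have hi : Function.Injective i := H.subtype_injective
  have hj : Function.Injective j := K.subtype_injective.comp φ.injective
  have hir : i.range = H := H.range_subtype
  have hjr : j.range = K := by
    rw [MonoidHom.range_comp, MonoidHom.range_eq_top.2 φ.surjective, ← MonoidHom.range_eq_map,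
      range_subtype]
  have main : ∀ X : Subgroup G, X.Normal → (∀ γ, i γ ∈ X ↔ j γ ∈ X) →
      (∀ r, r.Prime → r ∣ Nat.card X → ¬ (p = 2 ∧ r = 3) ∧ ¬ (p = 3 ∧ r = 2)) → X ≤ H := by
    intro X hX hmem hgood
    by_contra hle
    refine hK (hjr ▸ IsMaximalPair.isCoatom_right (p := p) (i := i) (j := j) (X := X) ?_)
    exact
      { isSolvable := hGs
        prime := hp
        injective_left := hi
        injective_right := hj
        normal := hX
        isCoatom := by rwa [hir]
        index_eq := ⟨a, by rw [hir, hidx]⟩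
        not_le := by rwa [hir]
        mem_iff := hmem
        good := hgood }
  have hp3 : p ≤ 3 := by
    by_contra hp3
    refine hH.1 (top_le_iff.1 (main ⊤ inferInstance (fun _ => by simp) fun r _ _ => ?_))
    omega
  have h2 := hp.two_le
  have hq : (5 - p).Prime := by
    interval_cases p <;> norm_num
  have hqp : 5 - p ≠ p := by omega
  set X := pPrimeCore (5 - p) G with hX
  have hXn : X.Normal := pPrimeCore_normal _
  have hcop : H.index.Coprime (5 - p) := by
    rw [hidx]
    exact Nat.Coprime.pow_left _ ((Nat.coprime_primes hp hq).2 hqp.symm)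
  have hcopK : K.index.Coprime (5 - p) := by
    rwa [← hjr, index_range_eq hi hj, hir]
  have hcore_i : pPrimeCore (5 - p) H = X.comap i :=
    map_pPrimeCore_eq_inf hGs hq i hi (by rwa [hir])
  have hcore_j : pPrimeCore (5 - p) H = X.comap j :=
    map_pPrimeCore_eq_inf hGs hq j hj (by rwa [hjr])
  have hcore_K : pPrimeCore (5 - p) K = X.comap K.subtype :=
    map_pPrimeCore_eq_inf hGs hq K.subtype K.subtype_injective (by rwa [range_subtype])
  have hmem : ∀ γ, i γ ∈ X ↔ j γ ∈ X := by
    intro γ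
    rw [← mem_comap, ← mem_comap, ← hcore_i, hcore_j]
  have hXH : X ≤ H := by
    refine main X hXn hmem fun r hr hrX => ?_
    have hc : (Nat.card X).Coprime (5 - p) := pPrimeCore_coprime _
    have hr' : r ≠ 5 - p := by
      rintro rfl
      exact hr.one_lt.ne' (Nat.eq_one_of_dvd_coprimes hc hrX dvd_rfl)
    omega
  have hXK : X ≤ K := by
    rw [← hjr]
    exact le_range_of_mem_iff hi hj hmem (by rwa [hir])
  let π := QuotientGroup.mk' X
  have hπ : Function.Surjective π := QuotientGroup.mk'_surjective X
  have hker : π.ker = X := QuotientGroup.ker_mk' X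
  refine ⟨hp3, ?_, ?_, G ⧸ X, inferInstance, π, hπ, hker, ?_, ?_, ?_⟩
  · rw [hcore_i, map_comap_eq, hir, inf_eq_right.2 hXH]
  · rw [hcore_K, map_comap_eq, range_subtype, inf_eq_right.2 hXK]
  · have h := nonempty_mulEquiv_map_of_ker_eq (i := i) (j := j) (π := π) (by
      ext γ
      rw [MonoidHom.mem_ker, MonoidHom.mem_ker, MonoidHom.comp_apply, MonoidHom.comp_apply,
        ← MonoidHom.mem_ker, ← MonoidHom.mem_ker, hker, hmem])
    rwa [hir, hjr] at h
  · exact isCoatom_map_of_surjective hπ (hker.le.trans hXH) hH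
  · exact fun h => hK (isCoatom_of_isCoatom_map hπ (hker.le.trans hXK) h)
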